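/- arXiv:1709.03550 — 3 statements merged into one kernel-verified Lean document; each statement's English description precedes it below -/
import Mathlib

section
/- Let A be a multiplicative Sidon set of positive integers. Then limsup_{n→∞} |A₂(n)| / (n^{3/4}/(log n)^3) < 73632. -/
open Filter

/-- `A` is a multiplicative Sidon set: for every `s`, the equation `x * y = s` has at most
one solution (up to ordering) with `x, y ∈ A`. -/
def MulSidon (A : Set ℕ) : Prop :=
  ∀ x ∈ A, ∀ y ∈ A, ∀ z ∈ A, ∀ w ∈ A, x * y = z * w → (x = z ∧ y = w) ∨ (x = w ∧ y = z)

/-- `a` has a decomposition witnessing membership in `A₂(n)`: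
`a ≥ n/(log n)^{12}` and `a = d * p_{s-3} * p_{s-2} * p_{s-1} * p_s` with `d ≤ (log n)^{12}`
and primes `n^{1/4}/(log n)^9 ≤ p_{s-3} ≤ p_{s-2} ≤ p_{s-1} ≤ p_s ≤ n^{1/4} (log n)^9`. -/
def ATwoCond (n a : ℕ) : Prop :=
  (n : ℝ) / (Real.log n) ^ 12 ≤ (a : ℝ) ∧
    ∃ d p₁ p₂ p₃ p₄ : ℕ, 0 < d ∧ (d : ℝ) ≤ (Real.log n) ^ 12 ∧
      p₁.Prime ∧ p₂.Prime ∧ p₃.Prime ∧ p₄.Prime ∧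
      p₁ ≤ p₂ ∧ p₂ ≤ p₃ ∧ p₃ ≤ p₄ ∧
      (n : ℝ) ^ ((1 : ℝ) / 4) / (Real.log n) ^ 9 ≤ (p₁ : ℝ) ∧
      (p₄ : ℝ) ≤ (n : ℝ) ^ ((1 : ℝ) / 4) * (Real.log n) ^ 9 ∧
      a = d * (p₁ * p₂ * p₃ * p₄)

theorem sum_log_mul_prime_le {f : ℕ → ℝ} (hf : ∀ k, 0 < k → f (k + 1) ≤ f k)
    (hf0 : ∀ k, 0 ≤ f k) (M : ℕ) :
    ∑ p ∈ Finset.Ioc 0 M with p.Prime, Real.log p * f p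
      ≤ Real.log 4 * ∑ k ∈ Finset.Ioc 0 M, f k := by
  have hθ : ∀ m : ℕ, ∑ p ∈ Finset.Ioc 0 m with p.Prime, Real.log p ≤ Real.log 4 * m := by
    intro m
    have := Chebyshev.theta_le_log4_mul_x (x := (m : ℝ)) (Nat.cast_nonneg m)
    simpa [Chebyshev.theta] using this
  have key : ∀ m : ℕ, ∑ p ∈ Finset.Ioc 0 m with p.Prime, Real.log p * f p
      + f m * (Real.log 4 * m - ∑ p ∈ Finset.Ioc 0 m with p.Prime, Real.log p)
      ≤ Real.log 4 * ∑ k ∈ Finset.Ioc 0 m, f k := by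
    intro m
    induction m with
    | zero => simp
    | succ m ih =>
      have hstep : (f (m + 1) - f m) *
          (Real.log 4 * m - ∑ p ∈ Finset.Ioc 0 m with p.Prime, Real.log p) ≤ 0 := by
        rcases Nat.eq_zero_or_pos m with rfl | hm
        · simp
        · exact mul_nonpos_of_nonpos_of_nonneg (by linarith [hf m hm]) (by linarith [hθ m])
      simp only [Finset.sum_filter] at ih hstep ⊢
      rw [Finset.sum_Ioc_succ_top (Nat.zero_le m), Finset.sum_Ioc_succ_top (Nat.zero_le m),
        Finset.sum_Ioc_succ_top (Nat.zero_le m)]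
      split_ifs <;> push_cast <;> nlinarith
  have h1 := key M
  have h2 := mul_nonneg (hf0 M) (sub_nonneg.2 (hθ M))
  linarith

/-- Sums of a decreasing function over primes all of whose logarithms are at least `l`. -/
theorem sum_prime_le {f : ℕ → ℝ} (hf : ∀ k, 0 < k → f (k + 1) ≤ f k)
    (hf0 : ∀ k, 0 ≤ f k) {l : ℝ} (hl : 0 < l) {P : Finset ℕ} {M : ℕ}
    (hP : ∀ p ∈ P, p.Prime ∧ p ≤ M ∧ l ≤ Real.log p) :
    ∑ p ∈ P, f p ≤ Real.log 4 / l * ∑ k ∈ Finset.Ioc 0 M, f k := by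
  have h1 : ∑ p ∈ P, l * f p ≤ ∑ p ∈ Finset.Ioc 0 M with p.Prime, Real.log p * f p := by
    calc ∑ p ∈ P, l * f p ≤ ∑ p ∈ P, Real.log p * f p :=
          Finset.sum_le_sum fun p hp => mul_le_mul_of_nonneg_right (hP p hp).2.2 (hf0 p)
      _ ≤ _ := by
          refine Finset.sum_le_sum_of_subset_of_nonneg (fun p hp => ?_) fun p _ _ =>
            mul_nonneg (Real.log_natCast_nonneg p) (hf0 p)
          have := hP p hp
          simp [this.1, this.1.pos, this.2.1]
  rw [← Finset.mul_sum] at h1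
  have h2 := h1.trans (sum_log_mul_prime_le hf hf0 M)
  rw [div_mul_eq_mul_div, le_div_iff₀ hl]
  linarith

theorem rpow_neg_le_sub {α : ℝ} (h0 : 0 ≤ α) (h1 : α < 1) (k : ℕ) :
    (1 - α) * ((k + 1 : ℕ) : ℝ) ^ (-α) ≤ ((k + 1 : ℕ) : ℝ) ^ (1 - α) - (k : ℝ) ^ (1 - α) := by
  have hx : (0 : ℝ) < ((k + 1 : ℕ) : ℝ) := by positivity
  set x : ℝ := ((k + 1 : ℕ) : ℝ) with hxd
  have hk : (k : ℝ) = x * (1 + -(1 / x)) := by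
    field_simp; rw [hxd]; push_cast; ring
  have hx1 : 1 / x ≤ 1 := by
    rw [div_le_one hx, hxd]; push_cast; linarith [(Nat.cast_nonneg k : (0:ℝ) ≤ k)]
  have hb := rpow_one_add_le_one_add_mul_self (s := -(1 / x)) (by linarith) (p := 1 - α)
    (by linarith) (by linarith)
  have hpow : x ^ (1 - α) = x * x ^ (-α) := by
    rw [sub_eq_add_neg, Real.rpow_add hx, Real.rpow_one]
  have hmul := mul_le_mul_of_nonneg_left hb (Real.rpow_nonneg hx.le (1 - α))
  rw [hk, Real.mul_rpow hx.le (by linarith)]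
  have : x ^ (1 - α) * ((1 - α) * (1 / x)) = (1 - α) * x ^ (-α) := by
    rw [hpow]; field_simp
  nlinarith

theorem rpow_neg_le_sub_of_one_lt {s : ℝ} (hs : 1 < s) {k : ℕ} (hk0 : 0 < k) :
    (s - 1) * ((k + 1 : ℕ) : ℝ) ^ (-s) ≤ (k : ℝ) ^ (1 - s) - ((k + 1 : ℕ) : ℝ) ^ (1 - s) := by
  have hx : (0 : ℝ) < ((k + 1 : ℕ) : ℝ) := by positivity
  have hkp : (0 : ℝ) < k := by exact_mod_cast hk0
  set x : ℝ := ((k + 1 : ℕ) : ℝ) with hxd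
  have hk : (k : ℝ) = x * (1 + -(1 / x)) := by
    field_simp; rw [hxd]; push_cast; ring
  have hy : 0 < 1 + -(1 / x) := by
    rw [hk] at hkp; exact pos_of_mul_pos_right hkp hx.le
  have hb : 1 + (s - 1) * (1 / x) ≤ (1 + -(1 / x)) ^ (1 - s) := by
    rw [Real.rpow_def_of_pos hy]
    have h1 := Real.log_le_sub_one_of_pos hy
    have h2 := Real.add_one_le_exp (Real.log (1 + -(1 / x)) * (1 - s))
    nlinarith
  have hpow : x ^ (1 - s) = x * x ^ (-s) := by
    rw [sub_eq_add_neg, Real.rpow_add hx, Real.rpow_one]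
  have hmul := mul_le_mul_of_nonneg_left hb (Real.rpow_nonneg hx.le (1 - s))
  rw [hk, Real.mul_rpow hx.le hy.le]
  have : x ^ (1 - s) * ((s - 1) * (1 / x)) = (s - 1) * x ^ (-s) := by
    rw [hpow]; field_simp
  nlinarith

theorem sum_rpow_le_of_le {α : ℝ} (h0 : 0 ≤ α) (h1 : α < 1) {T : ℝ} (hT : 0 ≤ T) (M : ℕ) :
    ∑ k ∈ Finset.Ioc 0 M, (if (k : ℝ) ≤ T then (k : ℝ) ^ (-α) else 0) ≤ T ^ (1 - α) / (1 - α) := by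
  have key : ∀ m : ℕ, (1 - α) * ∑ k ∈ Finset.Ioc 0 m, (if (k : ℝ) ≤ T then (k : ℝ) ^ (-α) else 0)
      ≤ (min (m : ℝ) T) ^ (1 - α) := by
    intro m
    induction m with
    | zero => simp only [Finset.Ioc_self, Finset.sum_empty, mul_zero]; positivity
    | succ m ih =>
      rw [Finset.sum_Ioc_succ_top (Nat.zero_le m), mul_add]
      split_ifs with h
      · have h2 : (m : ℝ) ≤ T := by push_cast at h; linarith
        rw [min_eq_left h]
        rw [min_eq_left h2] at ih
        linarith [rpow_neg_le_sub h0 h1 m]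
      · simp only [mul_zero, add_zero]
        refine ih.trans (Real.rpow_le_rpow (by positivity) ?_ (by linarith))
        exact min_le_min_right _ (by push_cast; linarith)
  rw [le_div_iff₀ (by linarith), mul_comm]
  exact (key M).trans (Real.rpow_le_rpow (by positivity) (min_le_right _ _) (by linarith))

theorem sum_rpow_le_of_ge {s : ℝ} (hs : 1 < s) {T : ℝ} (hT : 0 < T) (M : ℕ) :
    ∑ k ∈ Finset.Ioc 0 M, (if T ≤ (k : ℝ) then (k : ℝ) ^ (-s) else 0)
      ≤ s / (s - 1) * T ^ (1 - s) := by
  have key : ∀ m : ℕ,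
      (s - 1) * ∑ k ∈ Finset.Ioc 0 m, (if T ≤ (k : ℝ) then (k : ℝ) ^ (-s) else 0)
      ≤ if T ≤ (m : ℝ) then s * T ^ (1 - s) - (m : ℝ) ^ (1 - s) else 0 := by
    intro m
    induction m with
    | zero => simp [hT.not_ge]
    | succ m ih =>
      rw [Finset.sum_Ioc_succ_top (Nat.zero_le m), mul_add]
      by_cases h : T ≤ ((m + 1 : ℕ) : ℝ)
      · rw [if_pos h, if_pos h]
        by_cases h2 : T ≤ (m : ℝ)
        · rw [if_pos h2] at ih
          have hm : 0 < m := by exact_mod_cast hT.trans_le h2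
          linarith [rpow_neg_le_sub_of_one_lt hs hm]
        · rw [if_neg h2] at ih
          have hx : (0 : ℝ) < ((m + 1 : ℕ) : ℝ) := by positivity
          have e1 : ((m + 1 : ℕ) : ℝ) ^ (1 - s) ≤ T ^ (1 - s) :=
            Real.rpow_le_rpow_of_nonpos hT h (by linarith)
          have e2 : ((m + 1 : ℕ) : ℝ) ^ (-s) ≤ ((m + 1 : ℕ) : ℝ) ^ (1 - s) :=
            Real.rpow_le_rpow_of_exponent_le (by exact_mod_cast Nat.le_add_left 1 m)
              (by linarith)
          nlinarith
      · rw [if_neg h, if_neg h]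
        have h2 : ¬ T ≤ (m : ℝ) := by push_cast at h; linarith
        rw [if_neg h2] at ih
        linarith
  have h := key M
  rw [div_mul_eq_mul_div, le_div_iff₀ (by linarith), mul_comm]
  refine h.trans ?_
  split_ifs
  · linarith [Real.rpow_nonneg (Nat.cast_nonneg M : (0:ℝ) ≤ M) (1 - s)]
  · have := Real.rpow_nonneg hT.le (1 - s); nlinarith

theorem sum_min_rpow_le {α s a b T : ℝ} (h0 : 0 ≤ α) (h1 : α < 1) (hs : 1 < s) (ha : 0 ≤ a)
    (hb : 0 ≤ b) (hT : 0 < T) (M : ℕ) :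
    ∑ k ∈ Finset.Ioc 0 M, min (a * (k : ℝ) ^ (-α)) (b * (k : ℝ) ^ (-s))
      ≤ a * (T ^ (1 - α) / (1 - α)) + b * (s / (s - 1) * T ^ (1 - s)) := by
  refine le_trans ?_ (add_le_add (mul_le_mul_of_nonneg_left (sum_rpow_le_of_le h0 h1 hT.le M) ha)
    (mul_le_mul_of_nonneg_left (sum_rpow_le_of_ge hs hT M) hb))
  rw [Finset.mul_sum, Finset.mul_sum, ← Finset.sum_add_distrib]
  refine Finset.sum_le_sum fun k _ => ?_
  have n1 : 0 ≤ a * (k : ℝ) ^ (-α) := by positivity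
  have n2 : 0 ≤ b * (k : ℝ) ^ (-s) := by positivity
  rcases le_total (k : ℝ) T with h | h
  · rw [if_pos h]
    refine (min_le_left _ _).trans ?_
    split_ifs <;> linarith
  · rw [if_pos h]
    refine (min_le_right _ _).trans ?_
    split_ifs <;> linarith

theorem sum_prime_min_rpow_le {α s a b T : ℝ} (h0 : 0 ≤ α) (h1 : α < 1) (hs : 1 < s) (ha : 0 ≤ a)
    (hb : 0 ≤ b) (hT : 0 < T) {l : ℝ} (hl : 0 < l) {P : Finset ℕ} {M : ℕ}
    (hP : ∀ p ∈ P, p.Prime ∧ p ≤ M ∧ l ≤ Real.log p) :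
    ∑ p ∈ P, min (a * (p : ℝ) ^ (-α)) (b * (p : ℝ) ^ (-s))
      ≤ Real.log 4 / l * (a * (T ^ (1 - α) / (1 - α)) + b * (s / (s - 1) * T ^ (1 - s))) := by
  refine (sum_prime_le (f := fun k : ℕ => min (a * (k : ℝ) ^ (-α)) (b * (k : ℝ) ^ (-s)))
    (fun k hk => ?_) (fun k => by positivity) hl hP).trans
    (mul_le_mul_of_nonneg_left (sum_min_rpow_le h0 h1 hs ha hb hT M)
      (div_nonneg (Real.log_nonneg (by norm_num)) hl.le))
  have hk' : (0 : ℝ) < k := by exact_mod_cast hk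
  have hkk : (k : ℝ) ≤ ((k + 1 : ℕ) : ℝ) := by push_cast; linarith
  exact min_le_min
    (mul_le_mul_of_nonneg_left (Real.rpow_le_rpow_of_nonpos hk' hkk (by linarith)) ha)
    (mul_le_mul_of_nonneg_left (Real.rpow_le_rpow_of_nonpos hk' hkk (by linarith)) hb)

theorem sum_prime_rpow_le {α T : ℝ} (h0 : 0 ≤ α) (h1 : α < 1) (hT : 0 ≤ T)
    {l : ℝ} (hl : 0 < l) {P : Finset ℕ} {M : ℕ}
    (hP : ∀ p ∈ P, p.Prime ∧ p ≤ M ∧ l ≤ Real.log p) :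
    ∑ p ∈ P, (if (p : ℝ) ≤ T then (p : ℝ) ^ (-α) else 0)
      ≤ Real.log 4 / l * (T ^ (1 - α) / (1 - α)) := by
  refine (sum_prime_le (f := fun k : ℕ => if (k : ℝ) ≤ T then (k : ℝ) ^ (-α) else 0)
    (fun k hk => ?_) (fun k => by positivity) hl hP).trans
    (mul_le_mul_of_nonneg_left (sum_rpow_le_of_le h0 h1 hT M)
      (div_nonneg (Real.log_nonneg (by norm_num)) hl.le))
  have hk' : (0 : ℝ) < k := by exact_mod_cast hk
  have hkk : (k : ℝ) ≤ ((k + 1 : ℕ) : ℝ) := by push_cast; linarith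
  split_ifs with h h2 h2
  · exact Real.rpow_le_rpow_of_nonpos hk' hkk (by linarith)
  · exact absurd (hkk.trans h) h2
  · positivity
  · exact le_rfl

/-- A weighted form of the Kővári–Sós–Turán bound for bipartite graphs without 4-cycles. -/
theorem card_sq_le_of_forall_four_cycle {ι β γ : Type*} [DecidableEq ι] [DecidableEq β]
    [DecidableEq γ] (E : Finset ι) (v : ι → β) (u : ι → γ) (V : Finset β) (U : Finset γ)
    (hv : ∀ e ∈ E, v e ∈ V) (hu : ∀ e ∈ E, u e ∈ U) (w : β → ℝ) (h : γ → ℝ)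
    (hw : ∀ b, 0 ≤ w b) (hwh : ∀ e ∈ E, 1 ≤ w (v e) * h (u e)) {δ : ℝ}
    (hδ : ∀ e ∈ E, w (v e) ^ 2 ≤ δ)
    (H : ∀ e₁ ∈ E, ∀ e₂ ∈ E, ∀ e₃ ∈ E, ∀ e₄ ∈ E, u e₁ = u e₂ → u e₃ = u e₄ → v e₁ = v e₃ →
      v e₂ = v e₄ → e₁ ≠ e₂ → e₁ = e₃ ∧ e₂ = e₄) :
    (E.card : ℝ) ^ 2 ≤ (∑ c ∈ U, h c ^ 2) * ((∑ b ∈ V, w b) ^ 2 + δ * E.card) := by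
  have step1 : (E.card : ℝ) ≤ ∑ c ∈ U, h c * ∑ e ∈ E with u e = c, w (v e) := by
    calc (E.card : ℝ) = ∑ e ∈ E, (1 : ℝ) := by simp
      _ ≤ ∑ e ∈ E, h (u e) * w (v e) :=
          Finset.sum_le_sum fun e he => by rw [mul_comm]; exact hwh e he
      _ = ∑ c ∈ U, ∑ e ∈ E with u e = c, h (u e) * w (v e) :=
          (Finset.sum_fiberwise_of_maps_to hu _).symm
      _ = _ := by
          refine Finset.sum_congr rfl fun c _ => ?_
          rw [Finset.mul_sum]
          refine Finset.sum_congr rfl fun e he => ?_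
          rw [(Finset.mem_filter.1 he).2]
  have step2 : ∑ c ∈ U, (∑ e ∈ E with u e = c, w (v e)) ^ 2
      = ∑ x ∈ E ×ˢ E with u x.1 = u x.2, w (v x.1) * w (v x.2) := by
    rw [Finset.sum_filter, Finset.sum_product, ← Finset.sum_fiberwise_of_maps_to hu]
    refine Finset.sum_congr rfl fun c _ => ?_
    rw [sq, Finset.sum_mul_sum]
    refine Finset.sum_congr rfl fun e he => ?_
    rw [← Finset.sum_filter]
    refine Finset.sum_congr ?_ fun _ _ => rfl
    ext e'
    simp [(Finset.mem_filter.1 he).2, eq_comm]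
  have step3 : ∑ x ∈ E ×ˢ E with u x.1 = u x.2, w (v x.1) * w (v x.2)
      ≤ (∑ b ∈ V, w b) ^ 2 + δ * E.card := by
    rw [← Finset.sum_filter_add_sum_filter_not _ (fun x : ι × ι => x.1 ≠ x.2)]
    refine add_le_add ?_ ?_
    · rw [sq, Finset.sum_mul_sum, ← Finset.sum_product',
        ← Finset.sum_image (f := fun y : β × β => w y.1 * w y.2)
          (g := fun x : ι × ι => (v x.1, v x.2))]
      · refine Finset.sum_le_sum_of_subset_of_nonneg ?_ fun y _ _ => mul_nonneg (hw _) (hw _)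
        intro y hy
        simp only [Finset.mem_image, Finset.mem_filter, Finset.mem_product] at hy
        obtain ⟨x, ⟨⟨⟨hx1, hx2⟩, -⟩, -⟩, rfl⟩ := hy
        exact Finset.mem_product.2 ⟨hv _ hx1, hv _ hx2⟩
      · rintro ⟨e₁, e₂⟩ hx ⟨e₃, e₄⟩ hy hxy
        simp only [Finset.coe_filter, Finset.mem_filter, Finset.mem_product,
          Set.mem_ofPred_eq] at hx hy
        simp only [Prod.mk.injEq] at hxy
        obtain ⟨h1, h2⟩ := H e₁ hx.1.1.1 e₂ hx.1.1.2 e₃ hy.1.1.1 e₄ hy.1.1.2 hx.1.2 hy.1.2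
          hxy.1 hxy.2 hx.2
        rw [h1, h2]
    · have : ∑ x ∈ (E ×ˢ E).filter (fun x => u x.1 = u x.2) with ¬ x.1 ≠ x.2,
          w (v x.1) * w (v x.2) = ∑ e ∈ E, w (v e) ^ 2 := by
        symm
        refine Finset.sum_bij (fun e _ => (e, e)) ?_ ?_ ?_ ?_
        · intro e he; simp [he]
        · intro e _ e' _ hee; exact congrArg Prod.fst hee
        · rintro ⟨e, e'⟩ hx
          simp only [Finset.mem_filter, Finset.mem_product, not_not] at hx
          exact ⟨e, hx.1.1.1, by rw [hx.2]⟩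
        · intro e _; rw [sq]
      rw [this, mul_comm, ← nsmul_eq_mul]
      exact Finset.sum_le_card_nsmul _ _ _ hδ
  calc (E.card : ℝ) ^ 2 ≤ (∑ c ∈ U, h c * ∑ e ∈ E with u e = c, w (v e)) ^ 2 := by gcongr
    _ ≤ (∑ c ∈ U, h c ^ 2) * ∑ c ∈ U, (∑ e ∈ E with u e = c, w (v e)) ^ 2 :=
        Finset.sum_mul_sq_le_sq_mul_sq _ _ _
    _ ≤ _ := by
        rw [step2]
        exact mul_le_mul_of_nonneg_left step3 (Finset.sum_nonneg fun c _ => sq_nonneg _)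

theorem sum_pairs_rpow_le {n : ℝ} (hn : 0 < n) {l : ℝ} (hl : 0 < l) {P : Finset ℕ} {M : ℕ}
    (hP : ∀ p ∈ P, p.Prime ∧ p ≤ M ∧ l ≤ Real.log p) :
    ∑ x ∈ P ×ˢ P with x.1 ≤ x.2 ∧ (x.1 : ℝ) * (x.2 : ℝ) ^ 3 ≤ n,
      ((x.1 : ℝ) * x.2) ^ (-(3 / 4) : ℝ) ≤ 20 * (Real.log 4 / l) ^ 2 * n ^ (1 / 8 : ℝ) := by
  set κ := Real.log 4 / l with hκ
  have hκ0 : 0 ≤ κ := div_nonneg (Real.log_nonneg (by norm_num)) hl.le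
  rw [Finset.sum_filter, Finset.sum_product_right]
  have inner : ∀ q ∈ P, ∀ T : ℝ, 0 ≤ T →
      (∀ p : ℕ, p ≤ q → (p : ℝ) * (q : ℝ) ^ 3 ≤ n → (p : ℝ) ≤ T) →
      ∑ p ∈ P, (if p ≤ q ∧ (p : ℝ) * (q : ℝ) ^ 3 ≤ n then ((p : ℝ) * q) ^ (-(3 / 4) : ℝ) else 0)
        ≤ 4 * κ * (T ^ (1 / 4 : ℝ) * (q : ℝ) ^ (-(3 / 4) : ℝ)) := by
    intro q _ T hT hqT
    have h := sum_prime_rpow_le (α := 3 / 4) (by norm_num) (by norm_num) hT hl hP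
    calc _ ≤ ∑ p ∈ P, (q : ℝ) ^ (-(3 / 4) : ℝ) *
          (if (p : ℝ) ≤ T then (p : ℝ) ^ (-(3 / 4) : ℝ) else 0) := by
          refine Finset.sum_le_sum fun p _ => ?_
          split_ifs with h1 h2 h2
          · rw [Real.mul_rpow (by positivity) (by positivity), mul_comm]
          · exact absurd (hqT p h1.1 h1.2) h2
          · positivity
          · simp
      _ ≤ _ := by
          rw [← Finset.mul_sum]
          refine (mul_le_mul_of_nonneg_left h (by positivity)).trans (le_of_eq ?_)
          rw [← hκ]
          norm_num
          ring
  calc _ ≤ ∑ q ∈ P, min (4 * κ * (q : ℝ) ^ (-(1 / 2) : ℝ))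
        (4 * κ * n ^ (1 / 4 : ℝ) * (q : ℝ) ^ (-(3 / 2) : ℝ)) := by
        refine Finset.sum_le_sum fun q hq => ?_
        have hq0 : (0 : ℝ) < q := by exact_mod_cast (hP q hq).1.pos
        refine le_min ?_ ?_
        · refine (inner q hq q hq0.le fun p h1 _ => by exact_mod_cast h1).trans (le_of_eq ?_)
          rw [← Real.rpow_add hq0]
          norm_num
        · refine (inner q hq (n / (q : ℝ) ^ 3) (by positivity) fun p _ h2 => ?_).trans
            (le_of_eq ?_)
          · rwa [le_div_iff₀ (by positivity)]
          · rw [Real.div_rpow hn.le (by positivity), ← Real.rpow_natCast, ← Real.rpow_mul hq0.le,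
              div_mul_eq_mul_div, mul_div_assoc, ← Real.rpow_sub hq0]
            norm_num
            ring
    _ ≤ κ * (4 * κ * ((n ^ (1 / 4 : ℝ)) ^ (1 - 1 / 2 : ℝ) / (1 - 1 / 2)) + 4 * κ * n ^ (1 / 4 : ℝ) *
        (3 / 2 / (3 / 2 - 1) * (n ^ (1 / 4 : ℝ)) ^ (1 - 3 / 2 : ℝ))) :=
        sum_prime_min_rpow_le (by norm_num) (by norm_num) (by norm_num) (by positivity)
          (by positivity) (by positivity) hl hP
    _ = _ := by
        have e : n ^ (1 / 4 : ℝ) * n ^ (-(1 / 8) : ℝ) = n ^ (1 / 8 : ℝ) := by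
          rw [← Real.rpow_add hn]; norm_num
        rw [← Real.rpow_mul hn.le, ← Real.rpow_mul hn.le]
        norm_num at e ⊢
        linear_combination 12 * κ ^ 2 * e

theorem sum_min_sq_div_rpow_le {X : ℝ} (hX : 0 < X) {l : ℝ} (hl : 0 < l) {P : Finset ℕ} {M : ℕ}
    (hP : ∀ p ∈ P, p.Prime ∧ p ≤ M ∧ l ≤ Real.log p) :
    ∑ p ∈ P, ∑ q ∈ P, (if p ≤ q then (min ((p : ℝ) ^ 2) (X / (p * q))) ^ (3 / 2 : ℝ) else 0)
      ≤ 12 * (Real.log 4 / l) ^ 2 * X ^ (5 / 4 : ℝ) := by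
  set κ := Real.log 4 / l with hκ
  have hκ0 : 0 ≤ κ := div_nonneg (Real.log_nonneg (by norm_num)) hl.le
  have inner : ∀ p ∈ P, ∀ B T : ℝ, 0 ≤ B → 0 < T → (∀ q ∈ P, p ≤ q →
      (min ((p : ℝ) ^ 2) (X / (p * q))) ^ (3 / 2 : ℝ) ≤ B) →
      ∑ q ∈ P, (if p ≤ q then (min ((p : ℝ) ^ 2) (X / (p * q))) ^ (3 / 2 : ℝ) else 0)
      ≤ κ * (B * T + 3 * (X / p) ^ (3 / 2 : ℝ) * T ^ (-(1 / 2) : ℝ)) := by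
    intro p hp B T hB hT hpB
    have hp0 : (0 : ℝ) < p := by exact_mod_cast (hP p hp).1.pos
    have h := sum_prime_min_rpow_le (α := 0) (s := 3 / 2) (a := B) (b := (X / p) ^ (3 / 2 : ℝ))
      (T := T) le_rfl (by norm_num) (by norm_num) hB (by positivity) hT hl hP
    refine (Finset.sum_le_sum fun q hq => ?_).trans (h.trans (le_of_eq ?_))
    · have hq0 : (0 : ℝ) < q := by exact_mod_cast (hP q hq).1.pos
      split_ifs with hpq
      · refine le_min (by simpa using hpB q hq hpq) ?_
        rw [Real.rpow_neg hq0.le, ← div_eq_mul_inv, ← Real.div_rpow (by positivity) hq0.le,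
          div_div]
        exact Real.rpow_le_rpow (by positivity) (min_le_right _ _) (by norm_num)
      · positivity
    · rw [← hκ]
      norm_num
      left
      ring
  calc _ ≤ ∑ p ∈ P, min (4 * κ * X * (p : ℝ) ^ (-0 : ℝ))
        (4 * κ * X ^ (3 / 2 : ℝ) * (p : ℝ) ^ (-2 : ℝ)) := by
        refine Finset.sum_le_sum fun p hp => ?_
        have hp0 : (0 : ℝ) < p := by exact_mod_cast (hP p hp).1.pos
        obtain ⟨x, rfl⟩ : ∃ x, X = Real.exp x := ⟨_, (Real.exp_log hX).symm⟩
        obtain ⟨y, hy⟩ : ∃ y, (p : ℝ) = Real.exp y := ⟨_, (Real.exp_log hp0).symm⟩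
        refine le_min ?_ ?_
        · refine (inner p hp ((p : ℝ) ^ 3) (Real.exp x / (p : ℝ) ^ 3) (by positivity)
            (by positivity) fun q _ _ => ?_).trans (le_of_eq ?_)
          · have : ((p : ℝ) ^ 2) ^ (3 / 2 : ℝ) = (p : ℝ) ^ 3 := by
              rw [← Real.rpow_natCast, ← Real.rpow_natCast, ← Real.rpow_mul hp0.le]
              norm_num
            rw [← this]
            exact Real.rpow_le_rpow (by positivity) (min_le_left _ _) (by norm_num)
          · rw [mul_div_cancel₀ _ (by positivity)]
            have : (Real.exp x / p) ^ (3 / 2 : ℝ) * (Real.exp x / (p : ℝ) ^ 3) ^ (-(1 / 2) : ℝ)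
                = Real.exp x := by
              rw [hy, ← Real.exp_nat_mul, ← Real.exp_sub, ← Real.exp_sub, ← Real.exp_mul,
                ← Real.exp_mul, ← Real.exp_add]
              congr 1
              push_cast
              ring
            rw [neg_zero, Real.rpow_zero]
            linear_combination 3 * κ * this
        · refine (inner p hp ((Real.exp x / (p : ℝ) ^ 2) ^ (3 / 2 : ℝ)) p (by positivity)
            hp0 fun q hq hpq => ?_).trans (le_of_eq ?_)
          · refine Real.rpow_le_rpow (by positivity) ((min_le_right _ _).trans ?_) (by norm_num)
            have : (p : ℝ) ≤ q := by exact_mod_cast hpq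
            rw [sq]
            gcongr
          · have e1 : (Real.exp x / (p : ℝ) ^ 2) ^ (3 / 2 : ℝ) * p
                = Real.exp x ^ (3 / 2 : ℝ) * (p : ℝ) ^ (-2 : ℝ) := by
              rw [hy, ← Real.exp_nat_mul, ← Real.exp_sub, ← Real.exp_mul,
                ← Real.exp_mul, ← Real.exp_mul, ← Real.exp_add, ← Real.exp_add]
              congr 1
              push_cast
              ring
            have e2 : (Real.exp x / p) ^ (3 / 2 : ℝ) * (p : ℝ) ^ (-(1 / 2) : ℝ)
                = Real.exp x ^ (3 / 2 : ℝ) * (p : ℝ) ^ (-2 : ℝ) := by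
              rw [hy, ← Real.exp_sub, ← Real.exp_mul,
                ← Real.exp_mul, ← Real.exp_mul, ← Real.exp_mul, ← Real.exp_add, ← Real.exp_add]
              congr 1
              ring
            linear_combination κ * e1 + 3 * κ * e2
    _ ≤ κ * (4 * κ * X * ((X ^ (1 / 4 : ℝ)) ^ (1 - 0 : ℝ) / (1 - 0)) + 4 * κ * X ^ (3 / 2 : ℝ) *
        (2 / (2 - 1) * (X ^ (1 / 4 : ℝ)) ^ (1 - 2 : ℝ))) :=
        sum_prime_min_rpow_le le_rfl (by norm_num) (by norm_num) (by positivity)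
          (by positivity) (by positivity) hl hP
    _ = _ := by
        have e1 : X * X ^ (1 / 4 : ℝ) = X ^ (5 / 4 : ℝ) := by
          rw [← Real.rpow_one_add' hX.le (by norm_num)]; norm_num
        have e2 : X ^ (3 / 2 : ℝ) * X ^ (-(1 / 4) : ℝ) = X ^ (5 / 4 : ℝ) := by
          rw [← Real.rpow_add hX]; norm_num
        rw [← Real.rpow_mul hX.le, ← Real.rpow_mul hX.le]
        norm_num at e1 e2 ⊢
        linear_combination 4 * κ ^ 2 * e1 + 8 * κ ^ 2 * e2

theorem sum_triples_rpow_le {n : ℝ} (hn : 0 < n) {l : ℝ} (hl : 0 < l) {P : Finset ℕ} {M : ℕ}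
    (hP : ∀ p ∈ P, p.Prime ∧ p ≤ M ∧ l ≤ Real.log p) (D : ℕ) :
    ∑ y ∈ Finset.Ioc 0 D ×ˢ (P ×ˢ P) with y.2.1 ≤ y.2.2,
      ((min ((y.2.1 : ℝ) ^ 2) (n / (y.1 * (y.2.1 * y.2.2)))) ^ (3 / 4 : ℝ)) ^ 2
      ≤ 60 * (Real.log 4 / l) ^ 2 * n ^ (5 / 4 : ℝ) := by
  rw [Finset.sum_filter, Finset.sum_product]
  calc _ = ∑ d ∈ Finset.Ioc 0 D, ∑ p ∈ P, ∑ q ∈ P,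
        (if p ≤ q then (min ((p : ℝ) ^ 2) (n / d / (p * q))) ^ (3 / 2 : ℝ) else 0) := by
        refine Finset.sum_congr rfl fun d _ => ?_
        rw [Finset.sum_product]
        refine Finset.sum_congr rfl fun p _ => Finset.sum_congr rfl fun q _ => ?_
        rw [div_div, ← Real.rpow_natCast, ← Real.rpow_mul (by positivity)]
        norm_num
    _ ≤ ∑ d ∈ Finset.Ioc 0 D, 12 * (Real.log 4 / l) ^ 2 * n ^ (5 / 4 : ℝ) *
        (if 1 ≤ (d : ℝ) then (d : ℝ) ^ (-(5 / 4) : ℝ) else 0) := by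
        refine Finset.sum_le_sum fun d hd => ?_
        have hd0 : 0 < d := (Finset.mem_Ioc.1 hd).1
        have hd1 : (1 : ℝ) ≤ d := by exact_mod_cast hd0
        refine (sum_min_sq_div_rpow_le (by positivity) hl hP).trans (le_of_eq ?_)
        rw [if_pos hd1, Real.div_rpow hn.le (by positivity), Real.rpow_neg (by positivity)]
        ring
    _ ≤ 12 * (Real.log 4 / l) ^ 2 * n ^ (5 / 4 : ℝ) *
        (5 / 4 / (5 / 4 - 1) * 1 ^ (1 - 5 / 4 : ℝ)) := by
        rw [← Finset.mul_sum]
        exact mul_le_mul_of_nonneg_left (sum_rpow_le_of_ge (by norm_num) one_pos D)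
          (by positivity)
    _ = _ := by
        rw [Real.one_rpow]
        ring

/-- A quadratic inequality for the number of elements of a multiplicative Sidon set that are at
most `n` and of the form `d * p₁ * p₂ * p₃ * p₄` with primes `p₁ ≤ p₂ ≤ p₃ ≤ p₄`, all at least
`n ^ (1 / 5)`. -/
theorem MulSidon.card_sq_le {A : Set ℕ} (hS : MulSidon A) {n : ℕ} (hn : 1 < n) (E : Finset ℕ)
    (hE : ∀ a ∈ E, a ∈ A ∧ a ≤ n ∧ ∃ d p₁ p₂ p₃ p₄ : ℕ, 0 < d ∧
      p₁.Prime ∧ p₂.Prime ∧ p₃.Prime ∧ p₄.Prime ∧ p₁ ≤ p₂ ∧ p₂ ≤ p₃ ∧ p₃ ≤ p₄ ∧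
      (n : ℝ) ^ (1 / 5 : ℝ) ≤ p₁ ∧ a = d * (p₁ * p₂ * p₃ * p₄)) :
    (E.card : ℝ) ^ 2 ≤ 60 * (Real.log 4 / (Real.log n / 5)) ^ 2 * (n : ℝ) ^ (5 / 4 : ℝ) *
      ((20 * (Real.log 4 / (Real.log n / 5)) ^ 2 * (n : ℝ) ^ (1 / 8 : ℝ)) ^ 2
        + (n : ℝ) ^ (-(3 / 5) : ℝ) * E.card) := by
  have hn0 : (0 : ℝ) < n := by exact_mod_cast (zero_lt_one.trans hn)
  have hl : 0 < Real.log n / 5 := div_pos (Real.log_pos (by exact_mod_cast hn)) (by norm_num)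
  set P : Finset ℕ := {p ∈ Finset.Ioc 0 n | p.Prime ∧ (n : ℝ) ^ (1 / 5 : ℝ) ≤ p} with hPdef
  have hP : ∀ p ∈ P, p.Prime ∧ p ≤ n ∧ Real.log n / 5 ≤ Real.log p := by
    intro p hp
    simp only [hPdef, Finset.mem_filter, Finset.mem_Ioc] at hp
    refine ⟨hp.2.1, hp.1.2, ?_⟩
    have := Real.log_le_log (by positivity) hp.2.2
    rw [Real.log_rpow hn0] at this
    linarith
  choose! hA hle d p₁ p₂ p₃ p₄ hd h₁ h₂ h₃ h₄ h₁₂ h₂₃ h₃₄ hR ha using hE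
  have hmem : ∀ a ∈ E, ∀ p : ℕ, p.Prime → p ∣ a → p₁ a ≤ p → p ∈ P := by
    intro a hae p hp hpa hpp
    have ha0 : 0 < a := by
      rw [ha a hae]
      have := (h₁ a hae).pos; have := (h₂ a hae).pos; have := (h₃ a hae).pos
      have := (h₄ a hae).pos; have := hd a hae
      positivity
    simp only [hPdef, Finset.mem_filter, Finset.mem_Ioc]
    exact ⟨⟨hp.pos, (Nat.le_of_dvd ha0 hpa).trans (hle a hae)⟩, hp,
      (hR a hae).trans (by exact_mod_cast hpp)⟩
  have hm₁ : ∀ a ∈ E, p₁ a ∈ P := fun a hae => hmem a hae _ (h₁ a hae)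
    ⟨d a * (p₂ a * p₃ a * p₄ a), (ha a hae).trans (by ring)⟩ le_rfl
  have hm₂ : ∀ a ∈ E, p₂ a ∈ P := fun a hae => hmem a hae _ (h₂ a hae)
    ⟨d a * (p₁ a * p₃ a * p₄ a), (ha a hae).trans (by ring)⟩ (h₁₂ a hae)
  have hm₃ : ∀ a ∈ E, p₃ a ∈ P := fun a hae => hmem a hae _ (h₃ a hae)
    ⟨d a * (p₁ a * p₂ a * p₄ a), (ha a hae).trans (by ring)⟩ ((h₁₂ a hae).trans (h₂₃ a hae))
  have hm₄ : ∀ a ∈ E, p₄ a ∈ P := fun a hae => hmem a hae _ (h₄ a hae)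
    ⟨d a * (p₁ a * p₂ a * p₃ a), (ha a hae).trans (by ring)⟩
    ((h₁₂ a hae).trans ((h₂₃ a hae).trans (h₃₄ a hae)))
  have hprod : ∀ a ∈ E, (p₁ a * p₂ a : ℝ) * (d a * (p₃ a * p₄ a)) ≤ n := by
    intro a hae
    have h := hle a hae
    rw [ha a hae] at h
    have h' : ((d a * (p₁ a * p₂ a * p₃ a * p₄ a) : ℕ) : ℝ) ≤ n := by exact_mod_cast h
    push_cast at h'
    linarith
  have main := card_sq_le_of_forall_four_cycle E (fun a => (p₁ a, p₂ a))
    (fun a => (d a, p₃ a, p₄ a))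
    {x ∈ P ×ˢ P | x.1 ≤ x.2 ∧ (x.1 : ℝ) * (x.2 : ℝ) ^ 3 ≤ n}
    {y ∈ Finset.Ioc 0 n ×ˢ (P ×ˢ P) | y.2.1 ≤ y.2.2} ?_ ?_
    (fun x => ((x.1 : ℝ) * x.2) ^ (-(3 / 4) : ℝ))
    (fun y => (min ((y.2.1 : ℝ) ^ 2) (n / (y.1 * (y.2.1 * y.2.2)))) ^ (3 / 4 : ℝ))
    (fun x => by positivity) ?_ (δ := (n : ℝ) ^ (-(3 / 5) : ℝ)) ?_ ?_
  · refine main.trans (mul_le_mul (sum_triples_rpow_le hn0 hl hP n) ?_ (by positivity)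
      (by positivity))
    gcongr
    exact sum_pairs_rpow_le hn0 hl hP
  · intro a hae
    simp only [Finset.mem_filter, Finset.mem_product]
    refine ⟨⟨hm₁ a hae, hm₂ a hae⟩, h₁₂ a hae, le_trans ?_ (hprod a hae)⟩
    have e1 : (p₂ a : ℝ) ≤ p₃ a := by exact_mod_cast h₂₃ a hae
    have e2 : (p₂ a : ℝ) ≤ p₄ a := by exact_mod_cast (h₂₃ a hae).trans (h₃₄ a hae)
    have e3 : (1 : ℝ) ≤ d a := by exact_mod_cast hd a hae
    calc (p₁ a : ℝ) * (p₂ a : ℝ) ^ 3 = p₁ a * p₂ a * (1 * (p₂ a * p₂ a)) := by ring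
      _ ≤ _ := by gcongr
  · intro a hae
    simp only [Finset.mem_filter, Finset.mem_product, Finset.mem_Ioc]
    refine ⟨⟨⟨hd a hae, le_trans ?_ (hle a hae)⟩, hm₃ a hae, hm₄ a hae⟩, h₃₄ a hae⟩
    have h := (Nat.mul_pos (Nat.mul_pos (Nat.mul_pos (h₁ a hae).pos (h₂ a hae).pos)
      (h₃ a hae).pos) (h₄ a hae).pos)
    calc d a ≤ d a * (p₁ a * p₂ a * p₃ a * p₄ a) := Nat.le_mul_of_pos_right _ h
      _ = a := (ha a hae).symm
  · intro a hae
    have q₁ : (0 : ℝ) < p₁ a := by exact_mod_cast (h₁ a hae).pos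
    have q₂ : (0 : ℝ) < p₂ a := by exact_mod_cast (h₂ a hae).pos
    have q₃ : (0 : ℝ) < p₃ a := by exact_mod_cast (h₃ a hae).pos
    have q₄ : (0 : ℝ) < p₄ a := by exact_mod_cast (h₄ a hae).pos
    have q₀ : (0 : ℝ) < d a := by exact_mod_cast hd a hae
    have e1 : (p₁ a : ℝ) ≤ p₃ a := by exact_mod_cast (h₁₂ a hae).trans (h₂₃ a hae)
    have e2 : (p₂ a : ℝ) ≤ p₃ a := by exact_mod_cast h₂₃ a hae
    dsimp only
    rw [Real.rpow_neg (by positivity), ← div_eq_inv_mul, one_le_div (by positivity)]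
    refine Real.rpow_le_rpow (by positivity) (le_min ?_ ?_) (by norm_num)
    · rw [sq]; gcongr
    · rw [le_div_iff₀ (by positivity)]
      exact hprod a hae
  · intro a hae
    have e1 : (n : ℝ) ^ (1 / 5 : ℝ) ≤ p₂ a := (hR a hae).trans (by exact_mod_cast h₁₂ a hae)
    dsimp only
    rw [← Real.rpow_natCast, ← Real.rpow_mul (by positivity)]
    calc ((p₁ a : ℝ) * p₂ a) ^ (-(3 / 4) * (2 : ℕ) : ℝ)
        ≤ ((n : ℝ) ^ (1 / 5 : ℝ) * (n : ℝ) ^ (1 / 5 : ℝ)) ^ (-(3 / 4) * (2 : ℕ) : ℝ) := by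
          refine Real.rpow_le_rpow_of_nonpos (by positivity) ?_ (by norm_num)
          gcongr
          exact hR a hae
      _ = _ := by
          rw [← Real.rpow_add hn0, ← Real.rpow_mul hn0.le]
          norm_num
  · intro e₁ k₁ e₂ k₂ e₃ k₃ e₄ k₄ hu hu' hv hv' hne
    simp only [Prod.mk.injEq] at hu hu' hv hv'
    have hmul : e₁ * e₄ = e₂ * e₃ := by
      rw [ha e₁ k₁, ha e₂ k₂, ha e₃ k₃, ha e₄ k₄, hu.1, hu.2.1, hu.2.2, hu'.1, hu'.2.1, hu'.2.2,
        hv.1, hv.2, hv'.1, hv'.2]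
      ring
    rcases hS e₁ (hA _ k₁) e₄ (hA _ k₄) e₂ (hA _ k₂) e₃ (hA _ k₃) hmul with h | h
    · exact absurd h.1 hne
    · exact ⟨h.1, h.2.symm⟩

theorem eventually_mul_log_pow_le (C : ℝ) (k : ℕ) {s : ℝ} (hs : 0 < s) :
    ∀ᶠ n : ℕ in atTop, C * Real.log n ^ k ≤ (n : ℝ) ^ s := by
  have h := (isLittleO_log_rpow_rpow_atTop (k : ℝ) hs).const_mul_left C
  filter_upwards [tendsto_natCast_atTop_atTop.eventually (h.bound one_pos)] with n hn
  simp only [Real.rpow_natCast, one_mul] at hn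
  rw [Real.norm_of_nonneg (Real.rpow_nonneg (Nat.cast_nonneg n) s)] at hn
  exact (le_abs_self _).trans hn

theorem MulSidon.eventually_card_aTwo_le {A : Set ℕ} (hS : MulSidon A) :
    ∀ᶠ n : ℕ in atTop, (Nat.card {a : ℕ | a ∈ A ∩ Set.Icc 1 n ∧ ATwoCond n a} : ℝ) /
      ((n : ℝ) ^ ((3 : ℝ) / 4) / (Real.log n) ^ 3) ≤ 52000 := by
  filter_upwards [eventually_mul_log_pow_le 1 9 (s := 1 / 20) (by norm_num),
    eventually_mul_log_pow_le 3000 1 (s := 1 / 10) (by norm_num), eventually_gt_atTop 1]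
    with n hn9 hn1 hn
  have hn0 : (0 : ℝ) < n := by exact_mod_cast (zero_lt_one.trans hn)
  have hL : 0 < Real.log n := Real.log_pos (by exact_mod_cast hn)
  set L := Real.log n with hLdef
  have hfin : {a : ℕ | a ∈ A ∩ Set.Icc 1 n ∧ ATwoCond n a}.Finite :=
    (Set.finite_Icc 1 n).subset fun a ha => ha.1.2
  rw [Nat.card_coe_set_eq, Set.ncard_eq_toFinset_card _ hfin]
  have key := hS.card_sq_le hn hfin.toFinset (by
    intro a ha
    rw [Set.Finite.mem_toFinset] at ha
    obtain ⟨⟨haA, haI⟩, -, d, p₁, p₂, p₃, p₄, hd, -, h₁, h₂, h₃, h₄, h₁₂, h₂₃, h₃₄, hR, -, ha⟩ := ha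
    refine ⟨haA, haI.2, d, p₁, p₂, p₃, p₄, hd, h₁, h₂, h₃, h₄, h₁₂, h₂₃, h₃₄, le_trans ?_ hR, ha⟩
    rw [le_div_iff₀ (by positivity)]
    rw [one_mul] at hn9
    calc (n : ℝ) ^ (1 / 5 : ℝ) * L ^ 9 ≤ (n : ℝ) ^ (1 / 5 : ℝ) * (n : ℝ) ^ (1 / 20 : ℝ) := by gcongr
      _ = _ := by rw [← Real.rpow_add hn0]; norm_num)
  set e : ℝ := (hfin.toFinset.card : ℝ)
  have he : 0 ≤ e := Nat.cast_nonneg _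
  have hlog4 : Real.log 4 ≤ 1.3863 := by
    have : (4 : ℝ) = 2 ^ 2 := by norm_num
    rw [this, Real.log_pow]
    have := Real.log_two_lt_d9
    push_cast
    linarith
  have hlog40 : 0 ≤ Real.log 4 := Real.log_nonneg (by norm_num)
  set c := Real.log 4
  set Q : ℝ := (n : ℝ) ^ ((3 : ℝ) / 4) / L ^ 3 with hQ
  have hQ0 : 0 < Q := by positivity
  have hκ : c / (L / 5) = 5 * c / L := by field_simp
  have hmain : 60 * (5 * c / L) ^ 2 * (n : ℝ) ^ (5 / 4 : ℝ) *
      (20 * (5 * c / L) ^ 2 * (n : ℝ) ^ (1 / 8 : ℝ)) ^ 2 = 24000 * (5 * c) ^ 6 * Q ^ 2 := by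
    have e1 : (n : ℝ) ^ (5 / 4 : ℝ) * ((n : ℝ) ^ (1 / 8 : ℝ)) ^ 2 = ((n : ℝ) ^ (3 / 4 : ℝ)) ^ 2 := by
      rw [← Real.rpow_mul_natCast hn0.le, ← Real.rpow_mul_natCast hn0.le, ← Real.rpow_add hn0]
      norm_num
    rw [hQ]
    field_simp
    linear_combination 24000 * c ^ 6 * e1
  have herr : 60 * (5 * c / L) ^ 2 * (n : ℝ) ^ (5 / 4 : ℝ) * (n : ℝ) ^ (-(3 / 5) : ℝ) ≤ Q := by
    have e1 : (n : ℝ) ^ (5 / 4 : ℝ) * (n : ℝ) ^ (-(3 / 5) : ℝ) * (n : ℝ) ^ (1 / 10 : ℝ)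
        = (n : ℝ) ^ (3 / 4 : ℝ) := by
      rw [← Real.rpow_add hn0, ← Real.rpow_add hn0]
      norm_num
    rw [hQ, ← e1, le_div_iff₀ (by positivity), mul_assoc (60 * (5 * c / L) ^ 2)]
    have e2 : 60 * (5 * c / L) ^ 2 * ((n : ℝ) ^ (5 / 4 : ℝ) * (n : ℝ) ^ (-(3 / 5) : ℝ)) * L ^ 3
        = (n : ℝ) ^ (5 / 4 : ℝ) * (n : ℝ) ^ (-(3 / 5) : ℝ) * (1500 * c ^ 2 * L) := by
      field_simp
      ring
    rw [e2]
    refine mul_le_mul_of_nonneg_left (le_trans ?_ hn1) (by positivity)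
    rw [pow_one]
    gcongr
    nlinarith
  rw [← hLdef, hκ, mul_add, hmain, ← mul_assoc] at key
  have hc6 : 24000 * (5 * c) ^ 6 ≤ 51999 * 51999 := by
    calc 24000 * (5 * c) ^ 6 ≤ 24000 * (5 * 1.3863) ^ 6 := by gcongr
      _ ≤ _ := by norm_num
  rw [div_le_iff₀ hQ0]
  by_contra! hcon
  have k1 : e ^ 2 ≤ 51999 * 51999 * Q ^ 2 + Q * e := by
    refine key.trans (add_le_add ?_ ?_) <;> gcongr
  nlinarith [mul_pos hQ0 hQ0]

theorem stmt_12 (A : Set ℕ) (hpos : ∀ a ∈ A, 0 < a) (hS : MulSidon A) :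
    Filter.limsup (fun n : ℕ =>
        (((Nat.card {a : ℕ | a ∈ A ∩ Set.Icc 1 n ∧ ATwoCond n a} : ℝ) /
          ((n : ℝ) ^ ((3 : ℝ) / 4) / (Real.log n) ^ 3) : ℝ) : EReal)) atTop
      < ((73632 : ℝ) : EReal) := by
  refine lt_of_le_of_lt (limsup_le_of_le (a := ((52000 : ℝ) : EReal)) (by isBoundedDefault) ?_) ?_
  · filter_upwards [hS.eventually_card_aTwo_le] with n hn
    exact EReal.coe_le_coe_iff.2 hn
  · exact EReal.coe_lt_coe_iff.2 (by norm_num)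
end

section
/- For every integer k ≥ 11, the set P_k of primes p with 2^{k-1} < p < 2^k satisfies |P_k| ≥ 2^k / (4·log 2^k). -/
open Finset Nat in
theorem factorization_primorial_apply {p : ℕ} (hp : p.Prime) (n : ℕ) :
    (primorial n).factorization p = if p ≤ n then 1 else 0 := by
  split_ifs with h
  · refine le_antisymm ((squarefree_primorial n).natFactorization_le_one p) ?_
    exact (hp.dvd_iff_one_le_factorization (primorial_ne_zero n)).1 (hp.dvd_primorial_iff.2 h)
  · exact factorization_eq_zero_of_not_dvd fun hd => h (hp.dvd_primorial_iff.1 hd)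

theorem Nat.div_add_div_le_of_six_mul (m q : ℕ) :
    3 * m / q + 2 * (2 * m / q) ≤ 6 * m / q + m / q ∧
      (6 * m / q = 1 ∨ 6 * m / q = 2 →
        1 + (3 * m / q + 2 * (2 * m / q)) ≤ 6 * m / q + m / q) := by
  have h3 : 3 * m / q = 6 * m / q / 2 := by
    rw [Nat.div_div_eq_div_mul, show 6 * m = 3 * m * 2 by ring, Nat.mul_div_mul_right _ _ two_pos]
  have h2 : 2 * m / q = 6 * m / q / 3 := by
    rw [Nat.div_div_eq_div_mul, show 6 * m = 2 * m * 3 by ring,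
      Nat.mul_div_mul_right _ _ three_pos]
  have h1 : m / q = 6 * m / q / 6 := by
    rw [Nat.div_div_eq_div_mul, show 6 * m = m * 6 by ring, Nat.mul_div_mul_right _ _ (by simp)]
  rw [h3, h2, h1]
  omega

open Finset Nat in
theorem primorial_six_mul_dvd (m : ℕ) :
    primorial (6 * m) * ((3 * m)! * ((2 * m)! * (2 * m)!)) ∣
      primorial (2 * m) * ((6 * m)! * m !) := by
  have hf := Nat.factorial_ne_zero
  have hP := primorial_ne_zero
  rw [← Nat.factorization_prime_le_iff_dvd (by simp [hf, hP]) (by simp [hf, hP])]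
  intro p hp
  have hlog : ∀ {c : ℕ}, c ≤ 6 * m → Nat.log p c < Nat.log p (6 * m) + 1 := fun h =>
    Nat.lt_succ_of_le (Nat.log_mono_right h)
  rw [Nat.factorization_mul (hP _) (by simp [hf]), Nat.factorization_mul (hf _) (by simp [hf]),
    Nat.factorization_mul (hf _) (hf _), Nat.factorization_mul (hP _) (by simp [hf]),
    Nat.factorization_mul (hf _) (hf _)]
  simp only [Finsupp.add_apply, factorization_primorial_apply hp]
  rw [Nat.factorization_factorial hp (hlog (show 3 * m ≤ 6 * m by omega)),
    Nat.factorization_factorial hp (hlog (show 2 * m ≤ 6 * m by omega)),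
    Nat.factorization_factorial hp (hlog (show 6 * m ≤ 6 * m by omega)),
    Nat.factorization_factorial hp (hlog (show m ≤ 6 * m by omega))]
  have key := fun i => Nat.div_add_div_le_of_six_mul m (p ^ i)
  by_cases hmid : 2 * m < p ∧ p ≤ 6 * m
  · obtain ⟨h1, h2⟩ := hmid
    rw [if_pos h2, if_neg (by omega)]
    have hmem : 1 ∈ Ico 1 (Nat.log p (6 * m) + 1) := by
      have := Nat.log_pos hp.one_lt h2
      simp only [mem_Ico]; omega
    have hdiv : 6 * m / p = 1 ∨ 6 * m / p = 2 := by
      have ha : 1 ≤ 6 * m / p := (Nat.one_le_div_iff hp.pos).2 h2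
      have hb : 6 * m / p < 3 := (Nat.div_lt_iff_lt_mul hp.pos).2 (by omega)
      omega
    have := sum_le_sum (s := Ico 1 (Nat.log p (6 * m) + 1))
      (f := fun i => (if i = 1 then 1 else 0) + (3 * m / p ^ i + 2 * (2 * m / p ^ i)))
      (g := fun i => 6 * m / p ^ i + m / p ^ i) (fun i _ => by
        split_ifs with hi
        · subst hi
          exact (key 1).2 (by simpa using hdiv)
        · simpa using (key i).1)
    simp only [sum_add_distrib, sum_ite_eq', if_pos hmem, ← mul_sum] at this
    omega
  · have := sum_le_sum (s := Ico 1 (Nat.log p (6 * m) + 1)) fun i _ => (key i).1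
    simp only [sum_add_distrib, ← mul_sum] at this
    split_ifs <;> omega

open Nat in
theorem factorial_six_mul_mul_factorial_le (m : ℕ) :
    (6 * m)! * m ! ≤ 108 ^ m * ((3 * m)! * ((2 * m)! * (2 * m)!)) := by
  induction m with
  | zero => simp
  | succ m ih =>
    rw [show 6 * (m + 1) = 6 * m + 1 + 1 + 1 + 1 + 1 + 1 by ring,
      show 3 * (m + 1) = 3 * m + 1 + 1 + 1 by ring, show 2 * (m + 1) = 2 * m + 1 + 1 by ring]
    simp only [Nat.factorial_succ]
    set A := (6 * m)!
    set B := (3 * m)!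
    set C := (2 * m)!
    set D := (m)!
    set K := (m + 1) ^ 2 * (2 * m + 1) * (3 * m + 1) * (3 * m + 2) * 72
    calc _ = K * ((6 * m + 1) * (6 * m + 5)) * (A * D) := by simp only [K]; ring
      _ ≤ K * (9 * ((2 * m + 1) * (2 * m + 2))) * (108 ^ m * (B * (C * C))) := by
        exact Nat.mul_le_mul (Nat.mul_le_mul_left _ (by nlinarith)) ih
      _ = _ := by simp only [K]; ring

theorem primorial_six_mul_le (m : ℕ) : primorial (6 * m) ≤ 1728 ^ m := by
  have hpos : 0 < (3 * m).factorial * ((2 * m).factorial * (2 * m).factorial) := by positivity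
  refine Nat.le_of_mul_le_mul_right ?_ hpos
  calc _ ≤ primorial (2 * m) * ((6 * m).factorial * m.factorial) :=
        Nat.le_of_dvd (Nat.mul_pos (primorial_pos _) (by positivity)) (primorial_six_mul_dvd m)
    _ ≤ 4 ^ (2 * m) * (108 ^ m * ((3 * m).factorial * ((2 * m).factorial * (2 * m).factorial))) :=
        Nat.mul_le_mul (primorial_le_four_pow _) (factorial_six_mul_mul_factorial_le m)
    _ = _ := by rw [pow_mul, ← mul_assoc, ← mul_pow]; norm_num

open Finset in
theorem card_primes_Icc_one_le (s : ℕ) (hs : 2 ≤ s) :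
    #{p ∈ Icc 1 s | p.Prime} ≤ (s + 1) / 2 := by
  rw [← card_range ((s + 1) / 2)]
  refine card_le_card_of_injOn (fun p => if p = 2 then 0 else p / 2) ?_ ?_
  · intro p hp
    simp only [coe_filter, Set.mem_ofPred_eq, mem_Icc] at hp
    rcases hp.2.eq_two_or_odd with h | h
    · simp [h]; omega
    · rw [coe_range, Set.mem_Iio]
      dsimp only
      split_ifs <;> omega
  · intro p hp q hq hpq
    simp only [coe_filter, Set.mem_ofPred_eq, mem_Icc] at hp hq hpq
    have := hp.2.two_le
    have := hq.2.two_le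
    have := hp.2.eq_two_or_odd
    have := hq.2.eq_two_or_odd
    split_ifs at hpq <;> omega

open Finset Nat in
theorem centralBinom_le_pow_card_primes (n : ℕ) (hn : 2 < n) :
    centralBinom n ≤
      (2 * n) ^ #{p ∈ Ioc n (2 * n) | p.Prime} * (2 * n) ^ ((sqrt (2 * n) + 1) / 2) *
        primorial (2 * n / 3) := by
  set f : ℕ → ℕ := fun p => p ^ n.centralBinom.factorization p
  have hf_le : ∀ p, f p ≤ 2 * n := fun p => pow_factorization_choose_le (by omega)
  have hf_pos : ∀ p, p.Prime → 1 ≤ f p := fun p hp => Nat.one_le_pow _ _ hp.pos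
  have hsub : ∏ p ∈ range (2 * n + 1), f p ≤
      ∏ p ∈ ({p ∈ Ioc n (2 * n) | p.Prime} ∪ {p ∈ Icc 1 (sqrt (2 * n)) | p.Prime}) ∪
        {p ∈ Ioc (sqrt (2 * n)) (2 * n / 3) | p.Prime}, f p := by
    rw [← prod_filter_of_ne (p := fun p => p.Prime ∧ f p ≠ 1) (s := range (2 * n + 1))]
    · refine prod_le_prod_of_subset_of_one_le' ?_ ?_
      · intro p hp
        simp only [mem_filter, mem_range, mem_union, mem_Ioc, mem_Icc] at hp ⊢
        obtain ⟨h1, hp, h2⟩ := hp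
        have := hp.one_lt
        by_contra hcon
        have h3 : p ≤ n ∧ 2 * n / 3 < p := by
          simp only [hp, and_true] at hcon; omega
        refine h2 ?_
        simp only [f]
        rw [factorization_centralBinom_of_two_mul_self_lt_three_mul hn h3.1 (by omega), pow_zero]
      · intro p hp _
        simp only [mem_filter, mem_union] at hp
        exact hf_pos p (by tauto)
    · intro p _ h
      refine ⟨?_, h⟩
      by_contra hp
      exact h (by simp [f, factorization_eq_zero_of_not_prime _ hp])
  rw [← prod_pow_factorization_centralBinom]
  refine hsub.trans ?_
  have hunion : ∀ s t : Finset ℕ, (∀ p ∈ s, p.Prime) →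
      ∏ p ∈ s ∪ t, f p ≤ (∏ p ∈ s, f p) * ∏ p ∈ t, f p := by
    intro s t hs
    rw [← prod_union_inter]
    exact Nat.le_mul_of_pos_right _ (Finset.prod_pos fun p hp => hf_pos p (hs p (mem_inter.1 hp).1))
  refine (hunion _ _ ?_).trans (Nat.mul_le_mul ((hunion _ _ ?_).trans (Nat.mul_le_mul ?_ ?_)) ?_)
  · intro p hp
    simp only [mem_filter, mem_union] at hp
    tauto
  · simp
  · exact prod_le_pow_card _ _ _ fun p _ => hf_le p
  · refine (prod_le_pow_card _ _ _ fun p _ => hf_le p).trans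
      (Nat.pow_le_pow_right (by omega) (card_primes_Icc_one_le _ ?_))
    exact Nat.le_sqrt.2 (by omega)
  · refine (prod_le_prod' (g := fun p => p) fun p hp => ?_).trans
      (prod_le_prod_of_subset_of_one_le' ?_ ?_)
    · simp only [mem_filter, mem_Ioc] at hp
      exact (Nat.pow_le_pow_right hp.2.pos
        (factorization_choose_le_one (sqrt_lt'.mp hp.1.1))).trans (pow_one p).le
    · intro p hp
      simp only [mem_filter, mem_Ioc, mem_range] at hp ⊢
      exact ⟨by omega, hp.2⟩
    · intro p hp _
      exact (Nat.prime_of_mem_primesLE hp).one_lt.le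

open Finset in
theorem four_mul_le_card_primes (k n : ℕ) (hn : 2 * n = 2 ^ k) (hn4 : 4 ≤ n) :
    4 * n ≤ 5 * (k * (#{p ∈ Ioc n (2 * n) | p.Prime} + (Nat.sqrt (2 * n) + 1) / 2 + 1)) + 54 := by
  set T := #{p ∈ Ioc n (2 * n) | p.Prime}
  set s := (Nat.sqrt (2 * n) + 1) / 2
  have h1 : 4 ^ n ≤ (2 * n) ^ (T + s + 1) * 1728 ^ (n / 9 + 1) := by
    calc 4 ^ n ≤ 2 * n * n.centralBinom :=
          Nat.four_pow_le_two_mul_self_mul_centralBinom n (by omega)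
      _ ≤ 2 * n * ((2 * n) ^ T * (2 * n) ^ s * 1728 ^ (n / 9 + 1)) := by
          gcongr
          refine (centralBinom_le_pow_card_primes n (by omega)).trans ?_
          gcongr
          exact (primorial_mono (by omega)).trans (primorial_six_mul_le (n / 9 + 1))
      _ = _ := by ring
  have h2 : 2 ^ (10 * n) ≤ 2 ^ (5 * (k * (T + s + 1)) + 54 * (n / 9 + 1)) := by
    calc 2 ^ (10 * n) = (4 ^ n) ^ 5 := by
          rw [← pow_mul, show 10 * n = 2 * (n * 5) by ring, pow_mul]; norm_num
      _ ≤ ((2 * n) ^ (T + s + 1) * 1728 ^ (n / 9 + 1)) ^ 5 := Nat.pow_le_pow_left h1 5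
      _ = 2 ^ (5 * (k * (T + s + 1))) * (1728 ^ 5) ^ (n / 9 + 1) := by
          rw [hn, mul_pow, ← pow_mul, ← pow_mul, ← pow_mul, ← pow_mul]
          congr 2 <;> ring
      _ ≤ 2 ^ (5 * (k * (T + s + 1))) * (2 ^ 54) ^ (n / 9 + 1) := by
          exact Nat.mul_le_mul_left _ (Nat.pow_le_pow_left (by norm_num) _)
      _ = _ := by rw [← pow_mul, ← pow_add]
  have h3 := (Nat.pow_le_pow_iff_right (by norm_num)).1 h2
  omega

theorem sq_mul_le_two_pow (k : ℕ) (hk : 16 ≤ k) : k ^ 2 * 2 ^ 16 ≤ 16 ^ 2 * 2 ^ k := by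
  induction k, hk using Nat.le_induction with
  | base => norm_num
  | succ k hk ih =>
    rw [pow_succ 2 k]
    nlinarith

open Finset in
theorem card_primes_lower_bound_of_large (k : ℕ) (hk : 16 ≤ k) :
    10000 * 2 ^ k ≤ 27724 * (k * #{p ∈ Ioc (2 ^ (k - 1)) (2 ^ k) | p.Prime}) := by
  have hn : 2 * 2 ^ (k - 1) = 2 ^ k := by rw [← pow_succ']; congr 1; omega
  have hbig : 2 ^ 16 ≤ 2 ^ k := Nat.pow_le_pow_right (by norm_num) hk
  have main := four_mul_le_card_primes k (2 ^ (k - 1)) hn (by omega)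
  rw [hn] at main
  set T := #{p ∈ Ioc (2 ^ (k - 1)) (2 ^ k) | p.Prime}
  have hks := sq_mul_le_two_pow k hk
  set s := Nat.sqrt (2 ^ k)
  set x := 2 ^ k
  have hs : s * s ≤ x := Nat.sqrt_le x
  have hs' : x < (s + 1) * (s + 1) := Nat.lt_succ_sqrt x
  have hsk : 16 * k ≤ s + 1 := by nlinarith
  have hs_ge : 256 ≤ s := by nlinarith
  have hprod : 16 * (k * (s + 1)) ≤ (s + 1) * (s + 1) := by nlinarith
  have hhalf : 2 * (k * ((s + 1) / 2)) ≤ k * (s + 1) := by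
    have := Nat.mul_le_mul_left k (Nat.mul_div_le (s + 1) 2)
    linarith
  have e : k * (T + (s + 1) / 2 + 1) = k * T + k * ((s + 1) / 2) + k := by ring
  rw [e] at main
  nlinarith

/-- The number of `j` with `a ≤ j < a + 2 ^ d` for which `2 * j + 1` is coprime to `M`,
computed by bisection. -/
def oddCoprimeCount (M : ℕ) : ℕ → ℕ → ℕ
  | 0, a => 2 - Nat.gcd (2 * a + 1) M
  | d + 1, a => oddCoprimeCount M d a + oddCoprimeCount M d (a + 2 ^ d)

open Finset in
theorem oddCoprimeCount_eq (M d a : ℕ) :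
    oddCoprimeCount M d a = #{j ∈ Ico a (a + 2 ^ d) | (2 * j + 1).Coprime M} := by
  induction d generalizing a with
  | zero =>
    simp only [oddCoprimeCount, pow_zero, Nat.Ico_succ_singleton, filter_singleton, Nat.Coprime]
    by_cases h : Nat.gcd (2 * a + 1) M = 1
    · simp [h]
    · have : 0 < Nat.gcd (2 * a + 1) M := Nat.gcd_pos_of_pos_left M (by omega)
      simp only [h, if_false, card_empty]
      omega
  | succ d ih =>
    rw [oddCoprimeCount, ih, ih, pow_succ, mul_two, ← add_assoc,
      ← Ico_union_Ico_eq_Ico (Nat.le_add_right a (2 ^ d)) (Nat.le_add_right (a + 2 ^ d) (2 ^ d)),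
      filter_union, card_union_of_disjoint]
    exact disjoint_filter_filter (Ico_disjoint_Ico_consecutive _ _ _)

theorem Nat.prime_of_coprime_factorial {n B : ℕ} (h1 : 1 < n) (hB : n < (B + 1) ^ 2)
    (h : n.Coprime B.factorial) : n.Prime := by
  by_contra hn
  have := (Nat.coprime_factorial_iff h1.ne').1 h
  have := Nat.minFac_sq_le_self (by omega) hn
  nlinarith

open Finset in
theorem oddCoprimeCount_le_card_primes (k : ℕ) (hk : 2 ≤ k) (hk15 : k ≤ 15) :
    oddCoprimeCount (Nat.factorial 181) (k - 2) (2 ^ (k - 2)) ≤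
      #{p ∈ Ioc (2 ^ (k - 1)) (2 ^ k) | p.Prime} := by
  obtain ⟨d, rfl⟩ := Nat.exists_eq_add_of_le' hk
  have hd : 2 ^ (d + 2) ≤ 2 ^ 15 := Nat.pow_le_pow_right (by norm_num) hk15
  have hd1 : 1 ≤ 2 ^ d := Nat.one_le_two_pow
  rw [oddCoprimeCount_eq]
  refine card_le_card_of_injOn (fun j => 2 * j + 1) ?_ (fun a _ b _ h => by simpa using h)
  intro j hj
  simp only [coe_filter, Set.mem_ofPred_eq, mem_Ico, mem_Ioc, Nat.add_sub_cancel,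
    show d + 2 - 1 = d + 1 by omega, pow_succ] at hj hd ⊢
  exact ⟨by omega, Nat.prime_of_coprime_factorial (by omega) (by omega) hj.2⟩

open Finset in
theorem card_primes_lower_bound (k : ℕ) (hk : 11 ≤ k) :
    10000 * 2 ^ k ≤ 27724 * (k * #{p ∈ Ioc (2 ^ (k - 1)) (2 ^ k) | p.Prime}) := by
  rcases le_or_gt 16 k with h | h
  · exact card_primes_lower_bound_of_large k h
  · refine le_trans ?_ (Nat.mul_le_mul_left _
      (Nat.mul_le_mul_left k (oddCoprimeCount_le_card_primes k (by omega) (by omega))))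
    interval_cases k <;> decide +kernel

theorem stmt_15 (k : ℕ) (hk : 11 ≤ k) :
    (2 : ℝ) ^ k / (4 * Real.log ((2 : ℝ) ^ k)) ≤
      (Nat.card {p : ℕ | p.Prime ∧ 2 ^ (k - 1) < p ∧ p < 2 ^ k} : ℝ) := by
  have hset : {p : ℕ | p.Prime ∧ 2 ^ (k - 1) < p ∧ p < 2 ^ k} =
      ↑{p ∈ Finset.Ioc (2 ^ (k - 1)) (2 ^ k) | p.Prime} := by
    ext p
    simp only [Set.mem_ofPred_eq, Finset.coe_filter, Finset.mem_Ioc]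
    refine ⟨fun h => ⟨⟨h.2.1, h.2.2.le⟩, h.1⟩, fun h => ⟨h.2, h.1.1, h.1.2.lt_of_ne ?_⟩⟩
    rintro rfl
    exact Nat.Prime.not_prime_pow (by omega) h.2
  rw [hset, Nat.card_coe_set_eq, Set.ncard_coe_finset]
  have hmain := card_primes_lower_bound k hk
  set T := Finset.card {p ∈ Finset.Ioc (2 ^ (k - 1)) (2 ^ k) | p.Prime}
  have hmain' : (10000 : ℝ) * 2 ^ k ≤ 27724 * (k * T) := by exact_mod_cast hmain
  have hlog := Real.log_two_gt_d9
  have hk0 : (0 : ℝ) < k := by exact_mod_cast (by omega : 0 < k)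
  have hkT : (0 : ℝ) ≤ k * T := by positivity
  rw [Real.log_pow, div_le_iff₀ (by positivity)]
  nlinarith
end

section
/- There exists a multiplicative Sidon set A of positive integers such that for every integer n ≥ 2^{44}, |A(n)| ≥ π(n) + n^{3/4} / (196608·(log n)³). -/
/-! ### Counting primes in dyadic blocks -/

theorem card_primes_Ioc {m n : ℕ} (h : m ≤ n) :
    ((Finset.Ioc m n).filter Nat.Prime).card = n.primeCounting - m.primeCounting := by
  rw [← Nat.primesLE_card_eq_primeCounting, ← Nat.primesLE_card_eq_primeCounting,
    ← Finset.card_sdiff_of_subset (Nat.primesLE_mono h)]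
  congr 1
  ext p
  simp only [Finset.mem_filter, Finset.mem_Ioc, Finset.mem_sdiff, Nat.mem_primesLE]
  grind

/-- The estimate behind Bertrand's postulate, keeping track of the number of primes in
`(N, 2N]`. -/
theorem centralBinom_le_of_primeCounting {N : ℕ} (hN : 2 < N) :
    N.centralBinom ≤ (2 * N) ^ (Nat.sqrt (2 * N)) * 4 ^ (2 * N / 3) *
      (2 * N) ^ ((2 * N).primeCounting - N.primeCounting) := by
  have n2_pos : 1 ≤ 2 * N := by omega
  let S := {p ∈ Finset.range (2 * N + 1) | Nat.Prime p}
  let f x := x ^ N.centralBinom.factorization x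
  have hS : ∏ x ∈ S, f x = N.centralBinom := by
    rw [← N.prod_pow_factorization_centralBinom]
    refine Finset.prod_filter_of_ne fun p _ h => ?_
    contrapose h
    dsimp only [f]
    rw [Nat.factorization_eq_zero_of_not_prime N.centralBinom h, pow_zero]
  have hf : ∀ p, f p ≤ 2 * N := fun p => Nat.pow_factorization_choose_le (by omega)
  rw [← hS, ← Finset.prod_filter_mul_prod_filter_not S (· ≤ N)]
  refine Nat.mul_le_mul ?_ ?_
  · rw [← Finset.prod_filter_mul_prod_filter_not _ (· ≤ Nat.sqrt (2 * N))]
    refine Nat.mul_le_mul ?_ ?_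
    · refine (Finset.prod_le_prod' fun p _ => hf p).trans ?_
      rw [Finset.prod_const]
      have : (Finset.Icc 1 (Nat.sqrt (2 * N))).card = Nat.sqrt (2 * N) := by simp
      refine pow_right_mono₀ n2_pos ((Finset.card_le_card fun x hx => ?_).trans this.le)
      simp only [S, Finset.mem_filter] at hx
      exact Finset.mem_Icc.mpr ⟨hx.1.1.2.one_lt.le, hx.2⟩
    · refine le_trans ?_ (primorial_le_four_pow (2 * N / 3))
      have hsub : ∏ p ∈ (S.filter (· ≤ N)).filter (fun p => ¬ p ≤ Nat.sqrt (2 * N)), f p ≤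
          ∏ p ∈ (S.filter (· ≤ N)).filter (fun p => ¬ p ≤ Nat.sqrt (2 * N)),
            if p ≤ 2 * N / 3 then p else 1 := by
        refine Finset.prod_le_prod' fun p hp => ?_
        simp only [S, Finset.mem_filter, not_le] at hp
        split_ifs with h
        · refine (pow_right_mono₀ hp.1.1.2.one_lt.le ?_).trans (pow_one p).le
          exact Nat.factorization_choose_le_one (Nat.sqrt_lt'.mp hp.2)
        · dsimp only [f]
          rw [Nat.factorization_centralBinom_of_two_mul_self_lt_three_mul hN hp.1.2 (by omega),
            pow_zero]
      refine hsub.trans ?_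
      rw [← Finset.prod_filter, primorial]
      refine Finset.prod_le_prod_of_subset_of_one_le' ?_ ?_
      · intro p hp
        simp only [S, Finset.mem_filter, Finset.mem_range] at hp ⊢
        exact ⟨by omega, hp.1.1.1.2⟩
      · exact fun p hp _ => (Finset.mem_filter.1 hp).2.one_lt.le
  · refine (Finset.prod_le_prod' fun p _ => hf p).trans ?_
    rw [Finset.prod_const, ← card_primes_Ioc (by omega)]
    refine pow_right_mono₀ n2_pos (Finset.card_le_card fun x hx => ?_)
    simp only [S, Finset.mem_filter, Finset.mem_range, Finset.mem_Ioc] at hx ⊢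
    exact ⟨by omega, hx.1.2⟩

theorem two_pow_le_mul_primeCounting_sub {k : ℕ} (hk : 2 ≤ k) :
    2 * 2 ^ k ≤ 3 * k + 3 * (k + 1) * (Nat.sqrt (2 ^ (k + 1)) +
      ((2 ^ (k + 1)).primeCounting - (2 ^ k).primeCounting)) := by
  have h4 : 4 ≤ 2 ^ k := by
    calc 4 = 2 ^ 2 := by norm_num
      _ ≤ 2 ^ k := Nat.pow_le_pow_right (by norm_num) hk
  have h1 := Nat.four_pow_lt_mul_centralBinom (2 ^ k) h4
  have h2 := centralBinom_le_of_primeCounting (N := 2 ^ k) (by omega)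
  rw [← pow_succ'] at h2
  set s := Nat.sqrt (2 ^ (k + 1))
  set m := (2 ^ (k + 1)).primeCounting - (2 ^ k).primeCounting
  have h3 : (2 : ℕ) ^ (2 * 2 ^ k) <
      2 ^ (k + ((k + 1) * s + 2 * (2 ^ (k + 1) / 3) + (k + 1) * m)) := by
    calc (2 : ℕ) ^ (2 * 2 ^ k) = 4 ^ (2 ^ k) := by rw [pow_mul]; norm_num
      _ < _ := h1
      _ ≤ _ := Nat.mul_le_mul_left _ h2
      _ = _ := by
        simp only [pow_add, pow_mul]
        norm_num
  have h5 := (Nat.pow_lt_pow_iff_right (by norm_num : 1 < 2)).1 h3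
  have h6 : 2 ^ (k + 1) = 2 * 2 ^ k := pow_succ' 2 k
  have h7 : 3 * (k + 1) * (s + m) = 3 * ((k + 1) * s) + 3 * ((k + 1) * m) := by ring
  omega

theorem sixty_mul_sq_le_two_pow {k : ℕ} (hk : 13 ≤ k) : 60 * (k + 1) ^ 2 ≤ 2 ^ (k + 1) := by
  induction k, hk using Nat.le_induction with
  | base => norm_num
  | succ k hk ih =>
    rw [pow_succ 2 (k + 1)]
    nlinarith

theorem succ_mul_sqrt_le {k : ℕ} (hk : 13 ≤ k) :
    24 * ((k + 1) * (Nat.sqrt (2 ^ (k + 1)) + 16)) ≤ 7 * 2 ^ k := by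
  set s := Nat.sqrt (2 ^ (k + 1))
  have hs : s * s ≤ 2 ^ (k + 1) := Nat.sqrt_le _
  have h60 := sixty_mul_sq_le_two_pow hk
  have hs128 : 128 ≤ s := by
    rw [Nat.le_sqrt]
    calc 128 * 128 = 2 ^ (13 + 1) := by norm_num
      _ ≤ 2 ^ (k + 1) := Nat.pow_le_pow_right (by norm_num) (by omega)
  have h6 : 2 ^ (k + 1) = 2 * 2 ^ k := pow_succ' 2 k
  have h8 : 8 * (s + 16) ≤ 9 * s := by omega
  have h9 : (54 * (k + 1)) * s ≤ 7 * 2 ^ (k + 1) := by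
    have : (54 * (k + 1)) ^ 2 ≤ 49 * 2 ^ (k + 1) := by nlinarith
    have h10 : ((54 * (k + 1)) * s) ^ 2 ≤ (7 * 2 ^ (k + 1)) ^ 2 := by
      calc ((54 * (k + 1)) * s) ^ 2 = (54 * (k + 1)) ^ 2 * (s * s) := by ring
        _ ≤ (49 * 2 ^ (k + 1)) * 2 ^ (k + 1) := Nat.mul_le_mul this hs
        _ = _ := by ring
    exact (Nat.pow_le_pow_iff_left (by norm_num)).1 h10
  have h11 : (k + 1) * (8 * (s + 16)) ≤ (k + 1) * (9 * s) := Nat.mul_le_mul_left _ h8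
  nlinarith

theorem twenty_eight_le_primeCounting_sub :
    28 ≤ (2 ^ (10 + 1)).primeCounting - (2 ^ 10).primeCounting := by
  rw [← card_primes_Ioc (by norm_num)]
  let T : Finset ℕ := {1031, 1033, 1039, 1049, 1051, 1061, 1063, 1069, 1087, 1091, 1093, 1097,
    1103, 1109, 1117, 1123, 1129, 1151, 1153, 1163, 1171, 1181, 1187, 1193, 1201, 1213, 1217,
    1223}
  have hT : T.card = 28 := by decide
  rw [← hT]
  refine Finset.card_le_card fun p hp => ?_
  simp only [T, Finset.mem_insert, Finset.mem_singleton] at hp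
  rw [Finset.mem_filter, Finset.mem_Ioc]
  rcases hp with h | h | h | h | h | h | h | h | h | h | h | h | h | h | h | h | h | h | h | h |
    h | h | h | h | h | h | h | h <;> subst h <;> norm_num

theorem exists_code_parameters {k : ℕ} (hk : 10 ≤ k) :
    ∃ t q : ℕ, q.Prime ∧ 6 * t < q ∧
      3 * t + q ≤ (2 ^ (k + 1)).primeCounting - (2 ^ k).primeCounting ∧
      2 ^ k ≤ 40 * (k + 1) * t := by
  have hm := two_pow_le_mul_primeCounting_sub (k := k) (by omega)
  rcases (by omega : k = 10 ∨ k = 11 ∨ k = 12 ∨ 13 ≤ k) with rfl | rfl | rfl | hk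
  · exact ⟨3, 19, by norm_num, by norm_num, twenty_eight_le_primeCounting_sub, by norm_num⟩
  · have : Nat.sqrt (2 ^ (11 + 1)) = 64 := by norm_num
    rw [this] at hm
    exact ⟨5, 31, by norm_num, by norm_num, by omega, by norm_num⟩
  · have : Nat.sqrt (2 ^ (12 + 1)) ≤ 90 := by
      rw [← Nat.lt_succ_iff, Nat.sqrt_lt]
      norm_num
    exact ⟨8, 53, by norm_num, by norm_num, by omega, by norm_num⟩
  · have hs := succ_mul_sqrt_le hk
    set s := Nat.sqrt (2 ^ (k + 1))
    set m := (2 ^ (k + 1)).primeCounting - (2 ^ k).primeCounting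
    set D := 40 * (k + 1) with hD
    have hDpos : 0 < D := by omega
    set t := 2 ^ k / D + 1 with ht
    have htD : D * (2 ^ k / D) ≤ 2 ^ k := Nat.mul_div_le _ _
    have htD' : 2 ^ k < D * t := Nat.lt_mul_div_succ _ hDpos
    obtain ⟨q, hq, hq1, hq2⟩ := Nat.exists_prime_lt_and_le_two_mul (6 * t) (by simp [ht])
    refine ⟨t, q, hq, hq1, ?_, htD'.le⟩
    have h15 : 15 * t ≤ m := by
      have h1 : (k + 1) * (15 * t) ≤ (k + 1) * m := by
        have e1 : 8 * ((k + 1) * (15 * t)) = 3 * (D * (2 ^ k / D)) + 120 * (k + 1) := by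
          rw [ht, hD]; ring
        have e2 : 3 * (k + 1) * (s + m) = 3 * ((k + 1) * s) + 3 * ((k + 1) * m) := by ring
        have e3 : 24 * ((k + 1) * (s + 16)) = 24 * ((k + 1) * s) + 384 * (k + 1) := by ring
        linarith
      exact Nat.le_of_mul_le_mul_left h1 (by omega)
    omega

/-! ### Products of four primes -/

theorem Nat.Prime.exists_eq_of_dvd_prod {p : ℕ} (hp : p.Prime) {v : Fin 4 → ℕ}
    (hv : ∀ i, (v i).Prime) (h : p ∣ ∏ i, v i) : ∃ j, p = v j := by
  obtain ⟨j, -, hj⟩ := (Prime.dvd_finsetProd_iff hp.prime _).1 h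
  exact ⟨j, (Nat.prime_dvd_prime_iff_eq hp (hv j)).1 hj⟩

theorem cardFactors_prod_four {v : Fin 4 → ℕ} (hv : ∀ i, (v i).Prime) :
    ArithmeticFunction.cardFactors (∏ i, v i) = 4 := by
  have h0 := fun i => (hv i).ne_zero
  have h1 := fun i => ArithmeticFunction.cardFactors_apply_prime (hv i)
  rw [Fin.prod_univ_four, ArithmeticFunction.cardFactors_mul (by simp [h0]) (h0 _),
    ArithmeticFunction.cardFactors_mul (by simp [h0]) (h0 _),
    ArithmeticFunction.cardFactors_mul (h0 _) (h0 _), h1, h1, h1, h1]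

section Code

variable {C : Set (Fin 4 → ℕ)} (hp : ∀ v ∈ C, ∀ i, (v i).Prime)
  (hpos : ∀ u ∈ C, ∀ v ∈ C, ∀ i j, u i = v j → i = j)

include hp hpos

theorem eq_of_dvd_prod {u v : Fin 4 → ℕ} (hu : u ∈ C) (hv : v ∈ C) {i : Fin 4}
    (h : u i ∣ ∏ j, v j) : u i = v i := by
  obtain ⟨j, hj⟩ := (hp u hu i).exists_eq_of_dvd_prod (hp v hv) h
  obtain rfl := hpos u hu v hv i j hj
  exact hj

theorem eq_of_prod_eq {u v : Fin 4 → ℕ} (hu : u ∈ C) (hv : v ∈ C)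
    (h : ∏ j, u j = ∏ j, v j) : u = v :=
  funext fun i => eq_of_dvd_prod hp hpos hu hv (h ▸ Finset.dvd_prod_of_mem u (Finset.mem_univ i))

theorem eq_of_prime_mul_prod_eq
    (hdist : ∀ u ∈ C, ∀ v ∈ C, ∀ i, (∀ j, j ≠ i → u j = v j) → u = v)
    {p r : ℕ} (hr : r.Prime) {u v : Fin 4 → ℕ} (hu : u ∈ C) (hv : v ∈ C)
    (h : p * ∏ j, u j = r * ∏ j, v j) : p = r ∧ u = v := by
  have key : ∀ i, u i = r ∨ u i = v i := fun i => by
    have hd : u i ∣ r * ∏ j, v j :=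
      h ▸ (Finset.dvd_prod_of_mem u (Finset.mem_univ i)).mul_left p
    rcases (hp u hu i).dvd_mul.1 hd with h1 | h1
    · exact Or.inl ((Nat.prime_dvd_prime_iff_eq (hp u hu i) hr).1 h1)
    · exact Or.inr (eq_of_dvd_prod hp hpos hu hv h1)
  have huv : u = v := by
    by_cases hi : ∃ i, u i = r
    · obtain ⟨i, hi⟩ := hi
      refine hdist u hu v hv i fun j hj => (key j).resolve_left fun hj' => hj ?_
      exact hpos u hu u hu j i (hj'.trans hi.symm)
    · push Not at hi
      exact funext fun i => (key i).resolve_left (hi i)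
  subst huv
  exact ⟨Nat.eq_of_mul_eq_mul_right
    (Finset.prod_pos fun i _ => (hp u hu i).pos) h, rfl⟩

theorem mulSidon_primes_union_prod
    (hdist : ∀ u ∈ C, ∀ v ∈ C, ∀ i, (∀ j, j ≠ i → u j = v j) → u = v)
    (hswap : ∀ x ∈ C, ∀ y ∈ C, ∀ z ∈ C, ∀ w ∈ C,
      (∀ i, (x i = z i ∧ y i = w i) ∨ (x i = w i ∧ y i = z i)) → x = z ∨ x = w) :
    MulSidon ({p | p.Prime} ∪ {m | ∃ v ∈ C, m = ∏ i, v i}) := by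
  have mixed := @eq_of_prime_mul_prod_eq C hp hpos hdist
  have hΩ : ∀ v ∈ C, ArithmeticFunction.cardFactors (∏ i, v i) = 4 :=
    fun v hv => cardFactors_prod_four (hp v hv)
  have hne : ∀ v ∈ C, ∏ i, v i ≠ 0 :=
    fun v hv => (Finset.prod_pos fun i _ => (hp v hv i).pos).ne'
  intro x hx y hy z hz w hw h
  have hΩ' := congrArg ArithmeticFunction.cardFactors h
  rcases hx with (hx : x.Prime) | ⟨x, hx, rfl⟩ <;> rcases hy with (hy : y.Prime) | ⟨y, hy, rfl⟩ <;>
    rcases hz with (hz : z.Prime) | ⟨z, hz, rfl⟩ <;> rcases hw with (hw : w.Prime) | ⟨w, hw, rfl⟩ <;>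
    rw [ArithmeticFunction.cardFactors_mul (by first | exact hne _ ‹_› | exact hx.ne_zero)
      (by first | exact hne _ ‹_› | exact hy.ne_zero),
      ArithmeticFunction.cardFactors_mul (by first | exact hne _ ‹_› | exact hz.ne_zero)
      (by first | exact hne _ ‹_› | exact hw.ne_zero)] at hΩ' <;>
    simp only [ArithmeticFunction.cardFactors_apply_prime, *] at hΩ' <;>
    try omega
  · rcases hx.dvd_mul.1 (h ▸ dvd_mul_right x y) with h1 | h1
    · obtain rfl := (Nat.prime_dvd_prime_iff_eq hx hz).1 h1
      exact Or.inl ⟨rfl, Nat.eq_of_mul_eq_mul_left hx.pos h⟩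
    · obtain rfl := (Nat.prime_dvd_prime_iff_eq hx hw).1 h1
      exact Or.inr ⟨rfl, Nat.eq_of_mul_eq_mul_left hx.pos (h.trans (mul_comm _ _))⟩
  · obtain ⟨rfl, rfl⟩ := mixed hz hy hw h
    exact Or.inl ⟨rfl, rfl⟩
  · obtain ⟨rfl, rfl⟩ := mixed hw hy hz (h.trans (mul_comm _ _))
    exact Or.inr ⟨rfl, rfl⟩
  · obtain ⟨rfl, rfl⟩ := mixed hz hx hw ((mul_comm _ _).trans h)
    exact Or.inr ⟨rfl, rfl⟩
  · obtain ⟨rfl, rfl⟩ := mixed hw hx hz ((mul_comm _ _).trans (h.trans (mul_comm _ _)))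
    exact Or.inl ⟨rfl, rfl⟩
  · have key : ∀ {a b c : Fin 4 → ℕ} (e : ℕ), a ∈ C → b ∈ C → c ∈ C →
        (∏ i, a i) * e = (∏ i, b i) * ∏ i, c i → ∀ i, a i = b i ∨ a i = c i := by
      intro a b c e ha hb hc h i
      have hd : a i ∣ (∏ j, b j) * ∏ j, c j :=
        h ▸ (Finset.dvd_prod_of_mem a (Finset.mem_univ i)).mul_right e
      exact ((hp a ha i).dvd_mul.1 hd).imp (eq_of_dvd_prod hp hpos ha hb)
        (eq_of_dvd_prod hp hpos ha hc)
    have hxi := key _ hx hz hw h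
    have hyi := key _ hy hz hw ((mul_comm _ _).trans h)
    have hzi := key _ hz hx hy h.symm
    have hwi := key _ hw hx hy ((mul_comm _ _).trans h.symm)
    have hall : ∀ i, (x i = z i ∧ y i = w i) ∨ (x i = w i ∧ y i = z i) := fun i => by
      have := hxi i
      have := hyi i
      have := hzi i
      have := hwi i
      grind
    have hxpos := Nat.pos_of_ne_zero (hne x hx)
    rcases hswap x hx y hy z hz w hw hall with rfl | rfl
    · exact Or.inl ⟨rfl, Nat.eq_of_mul_eq_mul_left hxpos h⟩
    · exact Or.inr ⟨rfl, Nat.eq_of_mul_eq_mul_left hxpos (h.trans (mul_comm _ _))⟩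

end Code

/-! ### The surface `d = ab + bc + ca` over a prime field -/

theorem ZMod.natCast_inj_of_lt {q a b : ℕ} (ha : a < q) (hb : b < q)
    (h : (a : ZMod q) = b) : a = b := by
  rwa [ZMod.natCast_eq_natCast_iff', Nat.mod_eq_of_lt ha, Nat.mod_eq_of_lt hb] at h

theorem eq_of_line_value_eq {q : ℕ} (hq : q.Prime) {a a' b c : ℕ} (ha : a < q) (ha' : a' < q)
    (hbc : b + c < q) (hbc0 : 0 < b + c)
    (h : (a * (b + c) + b * c : ZMod q) = a' * (b + c) + b * c) : a = a' := by
  have := Fact.mk hq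
  have hne : (b + c : ZMod q) ≠ 0 := by
    intro h0
    have := ZMod.natCast_inj_of_lt (a := b + c) (b := 0) hbc (by omega) (by exact_mod_cast h0)
    omega
  refine ZMod.natCast_inj_of_lt ha ha' (mul_right_cancel₀ hne ?_)
  linear_combination h

theorem eq_or_eq_of_lines_meet_twice {q : ℕ} (hq : q.Prime) {a a' b b' c c' : ℕ}
    (ha : a < q) (ha' : a' < q) (hb : b < q) (hb' : b' < q) (hc : c < q) (hc' : c' < q)
    (hbc' : b ≠ c')
    (h1 : (a * (b + c) + b * c : ZMod q) = a * (b' + c') + b' * c')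
    (h2 : (a' * (b' + c') + b' * c' : ZMod q) = a' * (b + c) + b * c) :
    a = a' ∨ (b = b' ∧ c = c') := by
  have := Fact.mk hq
  have h3 : (a - a' : ZMod q) * (b + c - (b' + c')) = 0 := by linear_combination h1 + h2
  rcases mul_eq_zero.1 h3 with h4 | h4
  · exact Or.inl (ZMod.natCast_inj_of_lt ha ha' (sub_eq_zero.1 h4))
  · right
    have h5 : (b - b' : ZMod q) * (b - c') = 0 := by
      linear_combination (b + a : ZMod q) * h4 - h1
    have h6 : b = b' := by
      rcases mul_eq_zero.1 h5 with h6 | h6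
      · exact ZMod.natCast_inj_of_lt hb hb' (sub_eq_zero.1 h6)
      · exact absurd (ZMod.natCast_inj_of_lt hb hc' (sub_eq_zero.1 h6)) hbc'
    subst h6
    exact ⟨rfl, ZMod.natCast_inj_of_lt hc hc' (by linear_combination h4)⟩

/-! ### The code built from the primes in dyadic blocks -/

/-- The prime of index `i` among the primes exceeding `2 ^ k`. -/
noncomputable def blockPrime (k i : ℕ) : ℕ := Nat.nth Nat.Prime ((2 ^ k).primeCounting + i)

theorem blockPrime_prime (k i : ℕ) : (blockPrime k i).Prime := Nat.prime_nth_prime _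

theorem two_pow_lt_blockPrime (k i : ℕ) : 2 ^ k < blockPrime k i := by
  refine (Nat.count_le_iff_le_nth Nat.infinite_setOfPred_prime).1 ?_
  exact Nat.le_add_right _ _

theorem blockPrime_le {k i : ℕ} (hi : i < (2 ^ (k + 1)).primeCounting - (2 ^ k).primeCounting) :
    blockPrime k i ≤ 2 ^ (k + 1) := by
  refine Nat.le_of_lt_succ (Nat.nth_lt_of_lt_count ?_)
  change _ < (2 ^ (k + 1)).primeCounting
  omega

theorem blockPrime_inj {k l i j : ℕ}
    (hi : i < (2 ^ (k + 1)).primeCounting - (2 ^ k).primeCounting)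
    (hj : j < (2 ^ (l + 1)).primeCounting - (2 ^ l).primeCounting)
    (h : blockPrime k i = blockPrime l j) : k = l ∧ i = j := by
  have hkl : k = l := by
    have h1 := two_pow_lt_blockPrime k i
    have h2 := two_pow_lt_blockPrime l j
    have h3 := blockPrime_le hi
    have h4 := blockPrime_le hj
    have h5 := (Nat.pow_lt_pow_iff_right (by norm_num : 1 < 2)).1 (h1.trans_le (h ▸ h4))
    have h6 := (Nat.pow_lt_pow_iff_right (by norm_num : 1 < 2)).1 (h2.trans_le (h ▸ h3))
    omega
  subst hkl
  exact ⟨rfl, Nat.add_left_cancel (Nat.nth_injective Nat.infinite_setOfPred_prime h)⟩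

/-- The indices, in a block, of the four primes of a code word. The first three coordinates
range over disjoint intervals of length `t`, and the last one is the value of
`ab + bc + ca` modulo `q`, shifted beyond these intervals. -/
def codeIndex (t q a b c : ℕ) : Fin 4 → ℕ :=
  ![a, b, c, 3 * t + (a * b + b * c + c * a) % q]

/-- The admissible values of the first three coordinates of a code word. -/
def IsCodeTriple (t a b c : ℕ) : Prop :=
  a < t ∧ (t ≤ b ∧ b < 2 * t) ∧ 2 * t ≤ c ∧ c < 3 * t

section CodeIndex

variable {t q : ℕ} (hq : q.Prime) (htq : 6 * t < q)

include hq in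
theorem codeIndex_lt {a b c : ℕ} (h : IsCodeTriple t a b c) (i : Fin 4) :
    codeIndex t q a b c i < 3 * t + q := by
  have := Nat.mod_lt (a * b + b * c + c * a) hq.pos
  obtain ⟨h1, h2, h3⟩ := h
  fin_cases i <;> simp [codeIndex] <;> omega

theorem codeIndex_pos_inj {a b c a' b' c' : ℕ} (h : IsCodeTriple t a b c)
    (h' : IsCodeTriple t a' b' c') {i j : Fin 4}
    (hij : codeIndex t q a b c i = codeIndex t q a' b' c' j) : i = j := by
  obtain ⟨h1, h2, h3⟩ := h
  obtain ⟨h1', h2', h3'⟩ := h'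
  fin_cases i <;> fin_cases j <;> simp [codeIndex] at hij ⊢ <;> omega

include hq htq

theorem codeIndex_eq_of_dist_le_one {a b c a' b' c' : ℕ} (h : IsCodeTriple t a b c)
    (h' : IsCodeTriple t a' b' c') {i : Fin 4}
    (hi : ∀ j, j ≠ i → codeIndex t q a b c j = codeIndex t q a' b' c' j) :
    a = a' ∧ b = b' ∧ c = c' := by
  obtain ⟨h1, h2, h3⟩ := h
  obtain ⟨h1', h2', h3'⟩ := h'
  have e0 := hi 0
  have e1 := hi 1
  have e2 := hi 2
  have e3 := hi 3
  fin_cases i <;> simp [codeIndex] at e0 e1 e2 e3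
  · obtain rfl := e1
    obtain rfl := e2
    have := (ZMod.natCast_eq_natCast_iff' _ _ _).2 e3
    push_cast at this
    exact ⟨eq_of_line_value_eq hq (b := b) (c := c) (by omega) (by omega) (by omega) (by omega)
      (by linear_combination this), rfl, rfl⟩
  · obtain rfl := e0
    obtain rfl := e2
    have := (ZMod.natCast_eq_natCast_iff' _ _ _).2 e3
    push_cast at this
    exact ⟨rfl, eq_of_line_value_eq hq (b := a) (c := c) (by omega) (by omega) (by omega)
      (by omega) (by linear_combination this), rfl⟩
  · obtain rfl := e0
    obtain rfl := e1
    have := (ZMod.natCast_eq_natCast_iff' _ _ _).2 e3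
    push_cast at this
    exact ⟨rfl, rfl, eq_of_line_value_eq hq (b := a) (c := b) (by omega) (by omega) (by omega)
      (by omega) (by linear_combination this)⟩
  · exact ⟨e0, e1, e2⟩

/-- If the value of `ab + bc + ca` is compatible with exchanging a single coordinate between two
triples, then the exchange is trivial. -/
theorem eq_or_eq_of_exchange {a a' b b' c c' : ℕ}
    (ha : a < 3 * t) (ha' : a' < 3 * t) (hb : b < 3 * t) (hb' : b' < 3 * t)
    (hc : c < 3 * t) (hc' : c' < 3 * t) (hbc0 : 0 < b + c) (hbc' : b ≠ c')
    (h : ((a * b + b * c + c * a) % q = (a' * b + b * c + c * a') % q) ∨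
      ((a * b + b * c + c * a) % q = (a * b' + b' * c' + c' * a) % q ∧
        (a' * b' + b' * c' + c' * a') % q = (a' * b + b * c + c * a') % q)) :
    a = a' ∨ (b = b' ∧ c = c') := by
  rcases h with h | ⟨h, h'⟩
  · left
    have := (ZMod.natCast_eq_natCast_iff' _ _ _).2 h
    push_cast at this
    exact eq_of_line_value_eq hq (b := b) (c := c) (by omega) (by omega) (by omega) (by omega)
      (by linear_combination this)
  · have h1 := (ZMod.natCast_eq_natCast_iff' _ _ _).2 h
    have h2 := (ZMod.natCast_eq_natCast_iff' _ _ _).2 h'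
    push_cast at h1 h2
    exact eq_or_eq_of_lines_meet_twice hq (by omega) (by omega) (by omega) (by omega) (by omega)
      (by omega) hbc' (by linear_combination h1) (by linear_combination h2)

/-- Two code words are determined, up to order, by the unordered pairs of their coordinates. -/
theorem codeIndex_eq_or_eq_of_exchange {a₁ b₁ c₁ a₂ b₂ c₂ a₃ b₃ c₃ a₄ b₄ c₄ : ℕ}
    (h₁ : IsCodeTriple t a₁ b₁ c₁) (h₂ : IsCodeTriple t a₂ b₂ c₂)
    (h : ∀ i, (codeIndex t q a₁ b₁ c₁ i = codeIndex t q a₃ b₃ c₃ i ∧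
        codeIndex t q a₂ b₂ c₂ i = codeIndex t q a₄ b₄ c₄ i) ∨
      (codeIndex t q a₁ b₁ c₁ i = codeIndex t q a₄ b₄ c₄ i ∧
        codeIndex t q a₂ b₂ c₂ i = codeIndex t q a₃ b₃ c₃ i)) :
    (a₁ = a₃ ∧ b₁ = b₃ ∧ c₁ = c₃) ∨ (a₁ = a₄ ∧ b₁ = b₄ ∧ c₁ = c₄) := by
  obtain ⟨l1, l2, l3⟩ := h₁
  obtain ⟨m1, m2, m3⟩ := h₂
  have exch := @eq_or_eq_of_exchange t q hq htq
  have exch_a := @exch a₁ a₂ b₁ b₂ c₁ c₂ (by omega) (by omega) (by omega) (by omega) (by omega)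
    (by omega) (by omega) (by omega)
  have exch_b := @exch b₁ b₂ c₁ c₂ a₁ a₂ (by omega) (by omega) (by omega) (by omega) (by omega)
    (by omega) (by omega) (by omega)
  have exch_c := @exch c₁ c₂ a₁ a₂ b₁ b₂ (by omega) (by omega) (by omega) (by omega) (by omega)
    (by omega) (by omega) (by omega)
  have rot : ∀ a b c : ℕ, b * c + c * a + a * b = a * b + b * c + c * a := fun _ _ _ => by ring
  rw [rot a₁ b₁ c₁, rot a₁ b₂ c₁, rot a₂ b₁ c₂, rot a₂ b₂ c₂] at exch_b
  rw [← rot c₁ a₁ b₁, ← rot c₂ a₁ b₁, ← rot c₁ a₂ b₂, ← rot c₂ a₂ b₂] at exch_c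
  have e0 := h 0
  have e1 := h 1
  have e2 := h 2
  have e3 := h 3
  simp only [codeIndex, Matrix.cons_val, Nat.add_left_cancel_iff] at e0 e1 e2 e3
  rcases e0 with ⟨rfl, rfl⟩ | ⟨rfl, rfl⟩ <;> rcases e1 with ⟨rfl, rfl⟩ | ⟨rfl, rfl⟩ <;>
    rcases e2 with ⟨rfl, rfl⟩ | ⟨rfl, rfl⟩
  · exact Or.inl ⟨rfl, rfl, rfl⟩
  · rcases exch_c (e3.imp_left And.left) with e | ⟨e, e'⟩
    · exact Or.inl ⟨rfl, rfl, e⟩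
    · exact Or.inr ⟨e, e', rfl⟩
  · rcases exch_b (e3.imp_left And.left) with e | ⟨e, e'⟩
    · exact Or.inl ⟨rfl, e, rfl⟩
    · exact Or.inr ⟨e', rfl, e⟩
  · rcases exch_a (e3.symm.imp_left And.left) with e | ⟨e, e'⟩
    · exact Or.inr ⟨e, rfl, rfl⟩
    · exact Or.inl ⟨rfl, e, e'⟩
  · rcases exch_a (e3.imp_left And.left) with e | ⟨e, e'⟩
    · exact Or.inl ⟨e, rfl, rfl⟩
    · exact Or.inr ⟨rfl, e, e'⟩
  · rcases exch_b (e3.symm.imp_left And.left) with e | ⟨e, e'⟩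
    · exact Or.inr ⟨rfl, e, rfl⟩
    · exact Or.inl ⟨e', rfl, e⟩
  · rcases exch_c (e3.symm.imp_left And.left) with e | ⟨e, e'⟩
    · exact Or.inr ⟨rfl, rfl, e⟩
    · exact Or.inl ⟨e, e', rfl⟩
  · exact Or.inr ⟨rfl, rfl, rfl⟩

end CodeIndex

/-- Code words, as quadruples of primes, over all blocks `k ≥ 10`. -/
def blockCode (t q : ℕ → ℕ) : Set (Fin 4 → ℕ) :=
  {v | ∃ k a b c, 10 ≤ k ∧ IsCodeTriple (t k) a b c ∧
    ∀ i, v i = blockPrime k (codeIndex (t k) (q k) a b c i)}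

section BlockCode

variable {t q : ℕ → ℕ} (hq : ∀ k, 10 ≤ k → (q k).Prime) (htq : ∀ k, 10 ≤ k → 6 * t k < q k)
  (hcard : ∀ k, 10 ≤ k →
    3 * t k + q k ≤ (2 ^ (k + 1)).primeCounting - (2 ^ k).primeCounting)

theorem blockCode_prime {v : Fin 4 → ℕ} (hv : v ∈ blockCode t q) (i : Fin 4) : (v i).Prime := by
  obtain ⟨k, a, b, c, -, -, hv⟩ := hv
  exact hv i ▸ blockPrime_prime _ _

include hq hcard

theorem blockPrime_codeIndex_inj {k l a b c a' b' c' : ℕ} (hk : 10 ≤ k) (hl : 10 ≤ l)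
    (h : IsCodeTriple (t k) a b c) (h' : IsCodeTriple (t l) a' b' c') {i j : Fin 4}
    (hij : blockPrime k (codeIndex (t k) (q k) a b c i) =
      blockPrime l (codeIndex (t l) (q l) a' b' c' j)) :
    k = l ∧ codeIndex (t k) (q k) a b c i = codeIndex (t l) (q l) a' b' c' j :=
  blockPrime_inj ((codeIndex_lt (hq k hk) h i).trans_le (hcard k hk))
    ((codeIndex_lt (hq l hl) h' j).trans_le (hcard l hl)) hij

theorem blockCode_pos_inj {u v : Fin 4 → ℕ} (hu : u ∈ blockCode t q) (hv : v ∈ blockCode t q)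
    {i j : Fin 4} (hij : u i = v j) : i = j := by
  obtain ⟨k, a, b, c, hk, h, hu⟩ := hu
  obtain ⟨l, a', b', c', hl, h', hv⟩ := hv
  rw [hu, hv] at hij
  obtain ⟨rfl, hij⟩ := blockPrime_codeIndex_inj hq hcard hk hl h h' hij
  exact codeIndex_pos_inj h h' hij

include htq

theorem blockCode_eq_of_dist_le_one {u v : Fin 4 → ℕ} (hu : u ∈ blockCode t q)
    (hv : v ∈ blockCode t q) {i : Fin 4} (hi : ∀ j, j ≠ i → u j = v j) : u = v := by
  obtain ⟨k, a, b, c, hk, h, hu⟩ := hu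
  obtain ⟨l, a', b', c', hl, h', hv⟩ := hv
  have key : ∀ j, j ≠ i →
      k = l ∧ codeIndex (t k) (q k) a b c j = codeIndex (t l) (q l) a' b' c' j := fun j hj =>
    blockPrime_codeIndex_inj hq hcard hk hl h h' (by rw [← hu, ← hv, hi j hj])
  obtain ⟨j, hj⟩ := exists_ne i
  obtain ⟨rfl, -⟩ := key j hj
  obtain ⟨rfl, rfl, rfl⟩ := codeIndex_eq_of_dist_le_one (hq k hk) (htq k hk) h h'
    fun j hj => (key j hj).2
  exact funext fun j => (hu j).trans (hv j).symm

theorem blockCode_eq_of_exchange {x y z w : Fin 4 → ℕ} (hx : x ∈ blockCode t q)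
    (hy : y ∈ blockCode t q) (hz : z ∈ blockCode t q) (hw : w ∈ blockCode t q)
    (h : ∀ i, (x i = z i ∧ y i = w i) ∨ (x i = w i ∧ y i = z i)) : x = z ∨ x = w := by
  obtain ⟨kx, a₁, b₁, c₁, hkx, h₁, hx⟩ := hx
  obtain ⟨ky, a₂, b₂, c₂, hky, h₂, hy⟩ := hy
  obtain ⟨kz, a₃, b₃, c₃, hkz, h₃, hz⟩ := hz
  obtain ⟨kw, a₄, b₄, c₄, hkw, h₄, hw⟩ := hw
  have inj := @blockPrime_codeIndex_inj t q hq hcard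
  have hxz : ∀ i, x i = z i → kx = kz ∧ _ := fun i e =>
    inj hkx hkz h₁ h₃ ((hx i).symm.trans (e.trans (hz i)))
  have hxw : ∀ i, x i = w i → kx = kw ∧ _ := fun i e =>
    inj hkx hkw h₁ h₄ ((hx i).symm.trans (e.trans (hw i)))
  have hyz : ∀ i, y i = z i → ky = kz ∧ _ := fun i e =>
    inj hky hkz h₂ h₃ ((hy i).symm.trans (e.trans (hz i)))
  have hyw : ∀ i, y i = w i → ky = kw ∧ _ := fun i e =>
    inj hky hkw h₂ h₄ ((hy i).symm.trans (e.trans (hw i)))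
  by_cases hk : kx = ky
  · have hkz : kx = kz := by
      rcases h 0 with ⟨e, -⟩ | ⟨-, e⟩
      · exact (hxz 0 e).1
      · exact hk.trans (hyz 0 e).1
    have hkw : kx = kw := by
      rcases h 0 with ⟨-, e⟩ | ⟨e, -⟩
      · exact hk.trans (hyw 0 e).1
      · exact (hxw 0 e).1
    subst hk hkz hkw
    have key : ∀ i, _ := fun i => (h i).imp
      (fun e => And.intro (hxz i e.1).2 (hyw i e.2).2)
      (fun e => And.intro (hxw i e.1).2 (hyz i e.2).2)
    rcases codeIndex_eq_or_eq_of_exchange (hq kx hkx) (htq kx hkx) h₁ h₂ key with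
      ⟨rfl, rfl, rfl⟩ | ⟨rfl, rfl, rfl⟩
    · exact Or.inl (funext fun j => (hx j).trans (hz j).symm)
    · exact Or.inr (funext fun j => (hx j).trans (hw j).symm)
  · rcases h 0 with ⟨e, e'⟩ | ⟨e, e'⟩
    · have hkw := (hyw 0 e').1
      refine Or.inl (funext fun i => ?_)
      rcases h i with ⟨f, -⟩ | ⟨f, -⟩
      · exact f
      · exact absurd ((hxw i f).1.trans hkw.symm) hk
    · have hkz := (hyz 0 e').1
      refine Or.inr (funext fun i => ?_)
      rcases h i with ⟨f, -⟩ | ⟨f, -⟩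
      · exact absurd ((hxz i f).1.trans hkz.symm) hk
      · exact f

theorem mulSidon_primes_union_blockCode :
    MulSidon ({p | p.Prime} ∪ {m | ∃ v ∈ blockCode t q, m = ∏ i, v i}) :=
  mulSidon_primes_union_prod (fun _ hv => blockCode_prime hv)
    (fun _ hu _ hv _ _ => blockCode_pos_inj hq hcard hu hv)
    (fun _ hu _ hv _ => blockCode_eq_of_dist_le_one hq htq hcard hu hv)
    (fun _ hx _ hy _ hz _ hw => blockCode_eq_of_exchange hq htq hcard hx hy hz hw)

omit htq in
theorem primeCounting_add_pow_le_card {k n : ℕ} (hk : 10 ≤ k) (hn : 2 ^ (4 * k + 4) ≤ n) :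
    n.primeCounting + t k ^ 3 ≤
      Nat.card ↥(({p | p.Prime} ∪ {m | ∃ v ∈ blockCode t q, m = ∏ i, v i}) ∩ Set.Icc 1 n) := by
  classical
  let word : ℕ × ℕ × ℕ → Fin 4 → ℕ := fun s i =>
    blockPrime k (codeIndex (t k) (q k) s.1 (t k + s.2.1) (2 * t k + s.2.2) i)
  let T := Finset.range (t k) ×ˢ Finset.range (t k) ×ˢ Finset.range (t k)
  have htriple : ∀ s ∈ T, IsCodeTriple (t k) s.1 (t k + s.2.1) (2 * t k + s.2.2) := by
    intro s hs
    simp only [T, Finset.mem_product, Finset.mem_range] at hs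
    exact ⟨hs.1, by omega, by omega⟩
  have hword : ∀ s ∈ T, word s ∈ blockCode t q := fun s hs =>
    ⟨k, _, _, _, hk, htriple s hs, fun _ => rfl⟩
  let V := T.image fun s => ∏ i, word s i
  have hV : V.card = t k ^ 3 := by
    rw [Finset.card_image_of_injOn]
    · simp only [T, Finset.card_product, Finset.card_range]
      ring
    · intro s hs s' hs' h
      have hss' := eq_of_prod_eq (fun _ hv => blockCode_prime hv)
        (fun _ hu _ hv _ _ => blockCode_pos_inj hq hcard hu hv) (hword s hs) (hword s' hs') h
      have e := fun i => (blockPrime_codeIndex_inj hq hcard hk hk (htriple s hs)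
        (htriple s' hs') (congrFun hss' i)).2
      have e0 := e 0
      have e1 := e 1
      have e2 := e 2
      simp only [codeIndex, Matrix.cons_val, Nat.add_left_cancel_iff] at e0 e1 e2
      exact Prod.ext e0 (Prod.ext e1 e2)
  have hdisj : Disjoint n.primesLE V := by
    rw [Finset.disjoint_left]
    intro p hp hpV
    obtain ⟨s, hs, rfl⟩ := Finset.mem_image.1 hpV
    have h4 := cardFactors_prod_four fun i => blockCode_prime (hword s hs) i
    rw [ArithmeticFunction.cardFactors_apply_prime (Nat.prime_of_mem_primesLE hp)] at h4
    omega
  rw [← hV, ← Nat.primesLE_card_eq_primeCounting, ← Finset.card_union_of_disjoint hdisj,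
    ← Nat.card_eq_finsetCard]
  refine Nat.card_mono ((Set.finite_Icc 1 n).inter_of_right _) ?_
  intro m hm
  rcases Finset.mem_union.1 hm with hm | hm
  · have hmp := Nat.prime_of_mem_primesLE hm
    exact ⟨Or.inl hmp, hmp.one_le, Nat.le_of_mem_primesLE hm⟩
  · obtain ⟨s, hs, rfl⟩ := Finset.mem_image.1 hm
    refine ⟨Or.inr ⟨_, hword s hs, rfl⟩,
      Finset.prod_pos fun i _ => (blockCode_prime (hword s hs) i).pos, ?_⟩
    calc ∏ i, word s i ≤ ∏ _i : Fin 4, 2 ^ (k + 1) := Finset.prod_le_prod' fun i _ =>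
          blockPrime_le ((codeIndex_lt (hq k hk) (htriple s hs) i).trans_le (hcard k hk))
      _ = 2 ^ (4 * k + 4) := by
        rw [Finset.prod_const, ← pow_mul]
        congr 1
        simp
        ring
      _ ≤ n := hn

end BlockCode

theorem rpow_div_log_le {k n t : ℕ} (hn : 2 ^ (4 * k + 4) ≤ n) (hn' : n < 2 ^ (4 * k + 8))
    (ht : 2 ^ k ≤ 40 * (k + 1) * t) :
    (n : ℝ) ^ ((3 : ℝ) / 4) / (196608 * (Real.log n) ^ 3) ≤ (t : ℝ) ^ 3 := by
  have hpow : (n : ℝ) ^ ((3 : ℝ) / 4) ≤ 64 * (2 ^ k) ^ 3 := by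
    calc (n : ℝ) ^ ((3 : ℝ) / 4) ≤ (((2 : ℝ) ^ (k + 2)) ^ (4 : ℝ)) ^ ((3 : ℝ) / 4) := by
          refine Real.rpow_le_rpow (by positivity) ?_ (by norm_num)
          rw [Real.rpow_ofNat, ← pow_mul, show (k + 2) * 4 = 4 * k + 8 by ring]
          exact_mod_cast hn'.le
      _ = ((2 : ℝ) ^ (k + 2)) ^ 3 := by
          rw [← Real.rpow_mul (by positivity)]
          norm_num
      _ = 64 * (2 ^ k) ^ 3 := by ring
  have hlog : (4 * (k + 1)) * (0.6931 : ℝ) ≤ Real.log n := by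
    calc (4 * (k + 1)) * (0.6931 : ℝ) ≤ (4 * (k + 1)) * Real.log 2 := by
          gcongr
          linarith [Real.log_two_gt_d9]
      _ = Real.log (2 ^ (4 * k + 4)) := by
          rw [Real.log_pow]
          push_cast
          ring
      _ ≤ Real.log n := Real.log_le_log (by positivity) (by exact_mod_cast hn)
  have ht' : (2 : ℝ) ^ k ≤ 40 * (k + 1) * t := by exact_mod_cast ht
  have hlog0 : 0 < Real.log n := lt_of_lt_of_le (by positivity) hlog
  rw [div_le_iff₀ (by positivity)]
  calc (n : ℝ) ^ ((3 : ℝ) / 4) ≤ 64 * (2 ^ k) ^ 3 := hpow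
    _ ≤ 64 * (40 * (k + 1) * t) ^ 3 := by gcongr
    _ = (t : ℝ) ^ 3 * (4096000 * (k + 1) ^ 3) := by ring
    _ ≤ (t : ℝ) ^ 3 * (196608 * ((4 * (k + 1)) * (0.6931 : ℝ)) ^ 3) := by
        refine mul_le_mul_of_nonneg_left ?_ (by positivity)
        have : (0 : ℝ) ≤ (k + 1 : ℝ) ^ 3 := by positivity
        rw [mul_pow, mul_pow]
        nlinarith
    _ ≤ _ := by gcongr

theorem stmt_19 :
    ∃ A : Set ℕ, (∀ a ∈ A, 0 < a) ∧ MulSidon A ∧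
      ∀ n : ℕ, 2 ^ 44 ≤ n →
        (Nat.primeCounting n : ℝ) + (n : ℝ) ^ ((3 : ℝ) / 4) / (196608 * (Real.log n) ^ 3)
          ≤ (Nat.card ↥(A ∩ Set.Icc 1 n) : ℝ) := by
  have hex : ∀ k, ∃ t q : ℕ, 10 ≤ k → q.Prime ∧ 6 * t < q ∧
      3 * t + q ≤ (2 ^ (k + 1)).primeCounting - (2 ^ k).primeCounting ∧
      2 ^ k ≤ 40 * (k + 1) * t := fun k => by
    by_cases hk : 10 ≤ k
    · obtain ⟨t, q, h⟩ := exists_code_parameters hk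
      exact ⟨t, q, fun _ => h⟩
    · exact ⟨0, 0, fun h => absurd h hk⟩
  choose t q h using hex
  refine ⟨{p | p.Prime} ∪ {m | ∃ v ∈ blockCode t q, m = ∏ i, v i}, ?_,
    mulSidon_primes_union_blockCode (fun k hk => (h k hk).1) (fun k hk => (h k hk).2.1)
      (fun k hk => (h k hk).2.2.1), fun n hn => ?_⟩
  · rintro a (ha | ⟨v, hv, rfl⟩)
    · exact Nat.Prime.pos ha
    · exact Finset.prod_pos fun i _ => (blockCode_prime hv i).pos
  · have hn0 : n ≠ 0 := by
      rintro rfl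
      norm_num at hn
    have hlog : 44 ≤ Nat.log 2 n := Nat.le_log_of_pow_le (by norm_num) hn
    obtain ⟨k, hk, hk1, hk2⟩ :
        ∃ k, 10 ≤ k ∧ 4 * k + 4 ≤ Nat.log 2 n ∧ Nat.log 2 n < 4 * k + 8 :=
      ⟨Nat.log 2 n / 4 - 1, by omega, by omega, by omega⟩
    have h1 : 2 ^ (4 * k + 4) ≤ n := Nat.pow_le_of_le_log hn0 hk1
    have h2 : n < 2 ^ (4 * k + 8) := Nat.lt_pow_of_log_lt (by norm_num) hk2
    have h3 := primeCounting_add_pow_le_card (fun k hk => (h k hk).1)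
      (fun k hk => (h k hk).2.2.1) hk h1
    calc _ ≤ (n.primeCounting : ℝ) + (t k : ℝ) ^ 3 := by
          gcongr
          exact rpow_div_log_le h1 h2 (h k hk).2.2.2
      _ ≤ _ := by exact_mod_cast h3
end
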